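/- arXiv:2006.08166 — 2 statements merged into one kernel-verified Lean document; each statement's English description precedes it below -/
import Mathlib

section
/- Let p = q = 2, so n = 4. A triple (a, b, c) ∈ (ℝ⁴)³ belongs to Horn_hol(2,2) (i.e. a, b, c ∈ C_{2,2} and O_c ⊆ O_a + O_b) if and only if all of the following hold: a_1 ≥ a_2 > a_3 ≥ a_4; b_1 ≥ b_2 > b_3 ≥ b_4; c_1 ≥ c_2 > c_3 ≥ c_4; a_1+a_2+a_3+a_4+b_1+b_2+b_3+b_4 = c_1+c_2+c_3+c_4; a_1+a_2+b_1+b_2 ≤ c_1+c_2; a_2+b_2 ≤ c_2; a_2+b_1 ≤ c_1; a_1+b_2 ≤ c_1; a_3+b_3 ≥ c_3; a_3+b_4 ≥ c_4; a_4+b_3 ≥ c_4; a_2+a_4+b_2+b_4 ≤ c_1+c_4; a_2+a_4+b_2+b_4 ≤ c_2+c_3; a_2+a_4+b_1+b_4 ≤ c_1+c_3; a_1+a_4+b_2+b_4 ≤ c_1+c_3; a_2+a_4+b_2+b_3 ≤ c_1+c_3; a_2+a_3+b_2+b_4 ≤ c_1+c_3. -/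
open Matrix Complex Pointwise

noncomputable def Ipq (p q : ℕ) : Matrix (Fin (p + q)) (Fin (p + q)) ℂ :=
  Matrix.diagonal fun i => if (i : ℕ) < p then 1 else -1

/-- The pseudo-unitary group `U(p,q)` as a set of matrices. -/
def Upq (p q : ℕ) : Set (Matrix (Fin (p + q)) (Fin (p + q)) ℂ) :=
  {g | IsUnit g ∧ g * Ipq p q * g.conjTranspose = Ipq p q}

/-- The diagonal matrix with entries `i * x_k`. -/
noncomputable def dmat {n : ℕ} (x : Fin n → ℝ) : Matrix (Fin n) (Fin n) ℂ :=
  Matrix.diagonal fun i => Complex.I * (x i : ℂ)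

/-- The holomorphic chamber `C_{p,q}`: `x_1 ≥ ⋯ ≥ x_p > x_{p+1} ≥ ⋯ ≥ x_{p+q}`. -/
def Chol (p q : ℕ) : Set (Fin (p + q) → ℝ) :=
  {x | (∀ i j : Fin (p + q), (i : ℕ) ≤ (j : ℕ) → ((j : ℕ) < p ∨ p ≤ (i : ℕ)) → x j ≤ x i) ∧
       ∀ i j : Fin (p + q), (i : ℕ) < p → p ≤ (j : ℕ) → x j < x i}

/-- The adjoint orbit `O_x = {g d_x g⁻¹ : g ∈ U(p,q)}`. -/
def Orbit (p q : ℕ) (x : Fin (p + q) → ℝ) : Set (Matrix (Fin (p + q)) (Fin (p + q)) ℂ) :=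
  {Y | ∃ g ∈ Upq p q, Y = g * dmat x * g⁻¹}

/-- The Hermitian form `d₀|·|² + d₁|·|² - d₂|·|² - d₃|·|²` on `ℂ⁴`. -/
noncomputable def signedForm (d : Fin 4 → ℝ) (x y : Fin 4 → ℂ) : ℂ :=
  d 0 * (star (x 0) * y 0) + d 1 * (star (x 1) * y 1)
    - d 2 * (star (x 2) * y 2) - d 3 * (star (x 3) * y 3)

/-- The quadratic form of `signedForm`, as a real number. -/
noncomputable def signedQuad (d : Fin 4 → ℝ) (x : Fin 4 → ℂ) : ℝ :=
  d 0 * normSq (x 0) + d 1 * normSq (x 1) - d 2 * normSq (x 2) - d 3 * normSq (x 3)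

/-- The Gram determinant of two vectors for the form of signature `(2,2)`. -/
noncomputable def gramDet (x y : Fin 4 → ℂ) : ℝ :=
  signedQuad 1 x * signedQuad 1 y - normSq (signedForm 1 x y)

/-- `gramDet` times the trace of the form `d`, relative to the form of signature `(2,2)`,
on the span of two vectors. -/
noncomputable def gramTrace (d : Fin 4 → ℝ) (x y : Fin 4 → ℂ) : ℝ :=
  signedQuad 1 x * signedQuad d y + signedQuad 1 y * signedQuad d x
    - 2 * (signedForm 1 x y * signedForm d y x).re

lemma signedForm_self (d : Fin 4 → ℝ) (x : Fin 4 → ℂ) :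
    signedForm d x x = (signedQuad d x : ℂ) := by
  simp only [signedForm, signedQuad, Complex.star_def, ← Complex.normSq_eq_conj_mul_self]
  push_cast
  ring

lemma star_signedForm (d : Fin 4 → ℝ) (x y : Fin 4 → ℂ) :
    star (signedForm d x y) = signedForm d y x := by
  simp only [signedForm, star_add, star_sub, star_mul', Complex.star_def,
    Complex.conj_ofReal, Complex.conj_conj]
  ring

lemma signedForm_comb_right (d : Fin 4 → ℝ) (s t : ℂ) (x y z : Fin 4 → ℂ) :
    signedForm d z (s • x + t • y) = s * signedForm d z x + t * signedForm d z y := by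
  simp only [signedForm, Pi.add_apply, Pi.smul_apply, smul_eq_mul]
  ring

lemma signedForm_comb_left (d : Fin 4 → ℝ) (s t : ℂ) (x y z : Fin 4 → ℂ) :
    signedForm d (s • x + t • y) z
      = star s * signedForm d x z + star t * signedForm d y z := by
  simp only [signedForm, Pi.add_apply, Pi.smul_apply, smul_eq_mul, star_add, star_mul']
  ring

lemma two_re_eq (z : ℂ) : ((2 * z.re : ℝ) : ℂ) = z + star z := by
  rw [Complex.star_def, Complex.add_conj]

lemma gramDet_cast (x y : Fin 4 → ℂ) :
    (gramDet x y : ℂ) = signedForm 1 x x * signedForm 1 y y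
      - signedForm 1 x y * signedForm 1 y x := by
  rw [signedForm_self, signedForm_self, ← star_signedForm 1 x y, Complex.star_def,
    Complex.mul_conj]
  simp [gramDet]

lemma gramTrace_cast (d : Fin 4 → ℝ) (x y : Fin 4 → ℂ) :
    (gramTrace d x y : ℂ) = signedForm 1 x x * signedForm d y y
      + signedForm 1 y y * signedForm d x x
      - signedForm 1 x y * signedForm d y x - signedForm 1 y x * signedForm d x y := by
  have h := two_re_eq (signedForm 1 x y * signedForm d y x)
  rw [star_mul', star_signedForm, star_signedForm] at h
  simp only [gramTrace, Complex.ofReal_sub, Complex.ofReal_add, h, signedForm_self,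
    Complex.ofReal_mul]
  ring

lemma gramDet_comm (x y : Fin 4 → ℂ) : gramDet x y = gramDet y x := by
  apply Complex.ofReal_injective
  rw [gramDet_cast, gramDet_cast]
  ring

lemma gramTrace_comm (d : Fin 4 → ℝ) (x y : Fin 4 → ℂ) :
    gramTrace d x y = gramTrace d y x := by
  apply Complex.ofReal_injective
  rw [gramTrace_cast, gramTrace_cast]
  ring

lemma gramDet_comb (x y : Fin 4 → ℂ) (s t : ℂ) :
    gramDet x (s • x + t • y) = normSq t * gramDet x y := by
  apply Complex.ofReal_injective
  push_cast
  rw [gramDet_cast, gramDet_cast, Complex.normSq_eq_conj_mul_self]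
  simp only [signedForm_comb_left, signedForm_comb_right, Complex.star_def]
  ring

lemma gramTrace_comb (d : Fin 4 → ℝ) (x y : Fin 4 → ℂ) (s t : ℂ) :
    gramTrace d x (s • x + t • y) = normSq t * gramTrace d x y := by
  apply Complex.ofReal_injective
  push_cast
  rw [gramTrace_cast, gramTrace_cast, Complex.normSq_eq_conj_mul_self]
  simp only [signedForm_comb_left, signedForm_comb_right, Complex.star_def]
  ring

/-- The component of `v` orthogonal to `u` for the form of signature `(2,2)`, rescaled. -/
noncomputable def orthPart (u v : Fin 4 → ℂ) : Fin 4 → ℂ :=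
  signedForm 1 u u • v + (-signedForm 1 u v) • u

lemma signedQuad_orthPart (d : Fin 4 → ℝ) (u v : Fin 4 → ℂ) :
    signedQuad d (orthPart u v)
      = signedQuad 1 u * gramTrace d u v - gramDet u v * signedQuad d u := by
  apply Complex.ofReal_injective
  push_cast
  rw [gramTrace_cast, gramDet_cast, ← signedForm_self, ← signedForm_self, ← signedForm_self,
    orthPart]
  simp only [signedForm_comb_left, signedForm_comb_right, star_neg, star_signedForm]
  ring

lemma signedQuad_one_orthPart (u v : Fin 4 → ℂ) :
    signedQuad 1 (orthPart u v) = signedQuad 1 u * gramDet u v := by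
  apply Complex.ofReal_injective
  push_cast
  rw [gramDet_cast, ← signedForm_self, ← signedForm_self, orthPart]
  simp only [signedForm_comb_left, signedForm_comb_right, star_neg, star_signedForm]
  ring

lemma gramTrace_le_of_neg {d : Fin 4 → ℝ} {u v : Fin 4 → ℂ} {m M : ℝ}
    (hu : signedQuad 1 u < 0) (hG : gramDet u v < 0)
    (hm : signedQuad d u ≤ m * signedQuad 1 u)
    (hM : M * signedQuad 1 (orthPart u v) ≤ signedQuad d (orthPart u v)) :
    gramTrace d u v ≤ (m + M) * gramDet u v := by
  rw [signedQuad_one_orthPart, signedQuad_orthPart] at hM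
  have h : 0 ≤ gramDet u v * (signedQuad d u - m * signedQuad 1 u) :=
    mul_nonneg_of_nonpos_of_nonpos hG.le (by linarith)
  by_contra hcon
  push Not at hcon
  nlinarith [mul_pos_of_neg_of_neg hu (sub_neg.mpr hcon)]

lemma le_gramTrace_of_pos {d : Fin 4 → ℝ} {u v : Fin 4 → ℂ} {m M : ℝ}
    (hu : 0 < signedQuad 1 u)
    (hm : gramDet u v * (m * signedQuad 1 u) ≤ gramDet u v * signedQuad d u)
    (hM : M * signedQuad 1 (orthPart u v) ≤ signedQuad d (orthPart u v)) :
    (m + M) * gramDet u v ≤ gramTrace d u v := by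
  rw [signedQuad_one_orthPart, signedQuad_orthPart] at hM
  by_contra hcon
  push Not at hcon
  nlinarith [mul_pos hu (sub_pos.mpr hcon)]

lemma gramDet_neg_of_pos_of_neg {x y : Fin 4 → ℂ} (hx : 0 < signedQuad 1 x)
    (hy : signedQuad 1 y < 0) : gramDet x y < 0 := by
  have := mul_neg_of_pos_of_neg hx hy
  have := normSq_nonneg (signedForm 1 x y)
  rw [gramDet]
  linarith

lemma le_signedQuad {d : Fin 4 → ℝ} {M : ℝ} {v : Fin 4 → ℂ} (h₀ : v 0 = 0 ∨ M ≤ d 0)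
    (h₁ : v 1 = 0 ∨ M ≤ d 1) (h₂ : v 2 = 0 ∨ d 2 ≤ M) (h₃ : v 3 = 0 ∨ d 3 ≤ M) :
    M * signedQuad 1 v ≤ signedQuad d v := by
  have key (z : ℂ) (r : ℝ) (h : z = 0 ∨ 0 ≤ r) : 0 ≤ r * normSq z := by
    rcases h with rfl | h
    · simp
    · exact mul_nonneg h (normSq_nonneg z)
  have e₀ := key (v 0) (d 0 - M) (h₀.imp_right fun h => by linarith)
  have e₁ := key (v 1) (d 1 - M) (h₁.imp_right fun h => by linarith)
  have e₂ := key (v 2) (M - d 2) (h₂.imp_right fun h => by linarith)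
  have e₃ := key (v 3) (M - d 3) (h₃.imp_right fun h => by linarith)
  simp only [signedQuad, Pi.one_apply]
  linarith

lemma signedQuad_le {d : Fin 4 → ℝ} {M : ℝ} {v : Fin 4 → ℂ} (h₀ : v 0 = 0 ∨ d 0 ≤ M)
    (h₁ : v 1 = 0 ∨ d 1 ≤ M) (h₂ : v 2 = 0 ∨ M ≤ d 2) (h₃ : v 3 = 0 ∨ M ≤ d 3) :
    signedQuad d v ≤ M * signedQuad 1 v := by
  have h := le_signedQuad (d := -d) (M := -M) (v := v) (by simpa using h₀) (by simpa using h₁)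
    (by simpa using h₂) (by simpa using h₃)
  simp only [signedQuad, Pi.one_apply, Pi.neg_apply] at *
  linarith

lemma sum_normSq_pos {v : Fin 4 → ℂ} (hv : v ≠ 0) :
    0 < normSq (v 0) + normSq (v 1) + normSq (v 2) + normSq (v 3) := by
  obtain ⟨i, hi⟩ := Function.ne_iff.mp hv
  rw [← Fin.sum_univ_four (fun i => normSq (v i))]
  exact Finset.sum_pos' (fun i _ => normSq_nonneg _) ⟨i, Finset.mem_univ _, normSq_pos.mpr hi⟩

lemma signedQuad_one_pos {v : Fin 4 → ℂ} (hv : v ≠ 0) (h₂ : v 2 = 0) (h₃ : v 3 = 0) :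
    0 < signedQuad 1 v := by
  have := sum_normSq_pos hv
  simp only [signedQuad, Pi.one_apply, h₂, h₃, map_zero] at *
  linarith

lemma signedQuad_one_neg {v : Fin 4 → ℂ} (hv : v ≠ 0) (h₀ : v 0 = 0) (h₁ : v 1 = 0) :
    signedQuad 1 v < 0 := by
  have := sum_normSq_pos hv
  simp only [signedQuad, Pi.one_apply, h₀, h₁, map_zero] at *
  linarith

lemma orthPart_apply_eq_zero {u v : Fin 4 → ℂ} {i : Fin 4} (hu : u i = 0) (hv : v i = 0) :
    orthPart u v i = 0 := by
  simp [orthPart, hu, hv]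

lemma exists_positive_vector (φ : (Fin 4 → ℂ) →ₗ[ℂ] ℂ) :
    ∃ x : Fin 4 → ℂ, x ≠ 0 ∧ x 2 = 0 ∧ x 3 = 0 ∧ φ x = 0 := by
  obtain ⟨x, hf, hne⟩ := (Submodule.ne_bot_iff _).mp (LinearMap.ker_ne_bot_of_finrank_lt
    (f := (LinearMap.pi ![LinearMap.proj 2, LinearMap.proj 3, φ] :
      (Fin 4 → ℂ) →ₗ[ℂ] (Fin 3 → ℂ))) (by simp))
  have hf' := fun i => congrFun (LinearMap.mem_ker.mp hf) i
  exact ⟨x, hne, hf' 0, hf' 1, hf' 2⟩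

lemma exists_negative_vector (φ : (Fin 4 → ℂ) →ₗ[ℂ] ℂ) :
    ∃ x : Fin 4 → ℂ, x ≠ 0 ∧ x 0 = 0 ∧ x 1 = 0 ∧ φ x = 0 := by
  obtain ⟨x, hf, hne⟩ := (Submodule.ne_bot_iff _).mp (LinearMap.ker_ne_bot_of_finrank_lt
    (f := (LinearMap.pi ![LinearMap.proj 0, LinearMap.proj 1, φ] :
      (Fin 4 → ℂ) →ₗ[ℂ] (Fin 3 → ℂ))) (by simp))
  have hf' := fun i => congrFun (LinearMap.mem_ker.mp hf) i
  exact ⟨x, hne, hf' 0, hf' 1, hf' 2⟩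

/-- Injective linear maps preserving the Hermitian form of signature `(2,2)`. -/
structure IsPseudoIsometry (P : (Fin 4 → ℂ) →ₗ[ℂ] (Fin 4 → ℂ)) : Prop where
  ne_zero : ∀ x, x ≠ 0 → P x ≠ 0
  form : ∀ x y, signedForm 1 (P x) (P y) = signedForm 1 x y

lemma IsPseudoIsometry.quad {P : (Fin 4 → ℂ) →ₗ[ℂ] (Fin 4 → ℂ)} (hP : IsPseudoIsometry P)
    (x : Fin 4 → ℂ) : signedQuad 1 (P x) = signedQuad 1 x := by
  apply Complex.ofReal_injective
  rw [← signedForm_self, ← signedForm_self, hP.form]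

lemma IsPseudoIsometry.gramDet_map {P : (Fin 4 → ℂ) →ₗ[ℂ] (Fin 4 → ℂ)} (hP : IsPseudoIsometry P)
    (x y : Fin 4 → ℂ) : gramDet (P x) (P y) = gramDet x y := by
  simp only [gramDet, hP.quad, hP.form]

/-- A decomposition of the form `c` as the sum of pullbacks of the forms `a` and `b`. -/
structure IsFormSum (a b c : Fin 4 → ℝ) (P Q : (Fin 4 → ℂ) →ₗ[ℂ] (Fin 4 → ℂ)) : Prop where
  left : IsPseudoIsometry P
  right : IsPseudoIsometry Q
  sum : ∀ x y, signedForm c x y = signedForm a (P x) (P y) + signedForm b (Q x) (Q y)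

namespace IsFormSum

variable {a b c : Fin 4 → ℝ} {P Q : (Fin 4 → ℂ) →ₗ[ℂ] (Fin 4 → ℂ)}

lemma symm (h : IsFormSum a b c P Q) : IsFormSum b a c Q P :=
  ⟨h.right, h.left, fun x y => by rw [h.sum, add_comm]⟩

lemma quad (h : IsFormSum a b c P Q) (x : Fin 4 → ℂ) :
    signedQuad c x = signedQuad a (P x) + signedQuad b (Q x) := by
  apply Complex.ofReal_injective
  push_cast
  simp only [← signedForm_self, h.sum]

lemma gramTrace_eq (h : IsFormSum a b c P Q) (x y : Fin 4 → ℂ) :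
    gramTrace c x y = gramTrace a (P x) (P y) + gramTrace b (Q x) (Q y) := by
  apply Complex.ofReal_injective
  push_cast
  simp only [gramTrace_cast, h.sum, h.left.form, h.right.form]
  ring

/-- Comparison of relative traces on a plane of signature `(1,1)` spanned by `x` and `y`, and
also by `x` and `s • x + t • y`. -/
lemma trace_le (h : IsFormSum a b c P Q) {x y : Fin 4 → ℂ} {s t : ℂ} (ht : t ≠ 0)
    {mA MA mB MB mC MC : ℝ} (hx : 0 < signedQuad 1 x) (hy : signedQuad 1 y < 0)
    (hy' : signedQuad 1 (s • x + t • y) < 0)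
    (hC : signedQuad c x ≤ MC * signedQuad 1 x)
    (hC' : mC * signedQuad 1 (orthPart x y) ≤ signedQuad c (orthPart x y))
    (hA : signedQuad a (P y) ≤ mA * signedQuad 1 (P y))
    (hA' : MA * signedQuad 1 (orthPart (P y) (P x)) ≤ signedQuad a (orthPart (P y) (P x)))
    (hB : signedQuad b (Q (s • x + t • y)) ≤ mB * signedQuad 1 (Q (s • x + t • y)))
    (hB' : MB * signedQuad 1 (orthPart (Q (s • x + t • y)) (Q x))
      ≤ signedQuad b (orthPart (Q (s • x + t • y)) (Q x))) :
    mA + MA + mB + MB ≤ MC + mC := by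
  have hG := gramDet_neg_of_pos_of_neg hx hy
  have hG' := gramDet_neg_of_pos_of_neg hx hy'
  have eA := gramTrace_le_of_neg (by rwa [h.left.quad])
    (by rwa [h.left.gramDet_map, gramDet_comm]) hA hA'
  have eB := gramTrace_le_of_neg (by rwa [h.right.quad])
    (by rwa [h.right.gramDet_map, gramDet_comm]) hB hB'
  have eC := le_gramTrace_of_pos hx (m := MC)
    (mul_le_mul_of_nonpos_left hC hG.le) hC'
  rw [gramTrace_comm, gramDet_comm, h.left.gramDet_map] at eA
  rw [gramTrace_comm, gramDet_comm, h.right.gramDet_map, gramDet_comb, map_add, map_smul, map_smul,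
    gramTrace_comb] at eB
  rw [h.gramTrace_eq] at eC
  have ht' : 0 < normSq t := normSq_pos.mpr ht
  have eB' : gramTrace b (Q x) (Q y) ≤ (mB + MB) * gramDet x y := by
    refine le_of_mul_le_mul_left ?_ ht'
    linarith
  by_contra hcon
  push Not at hcon
  nlinarith [mul_pos_of_neg_of_neg hG (sub_neg.mpr hcon)]

lemma exists_signature_plane (h : IsFormSum a b c P Q) (φ ψ : (Fin 4 → ℂ) →ₗ[ℂ] ℂ) :
    ∃ (x y : Fin 4 → ℂ) (s : ℂ), x ≠ 0 ∧ x 2 = 0 ∧ x 3 = 0 ∧ y ≠ 0 ∧ P y 0 = 0 ∧ P y 1 = 0 ∧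
      s • x + (1 : ℂ) • y ≠ 0 ∧ Q (s • x + (1 : ℂ) • y) 0 = 0 ∧
      Q (s • x + (1 : ℂ) • y) 1 = 0 ∧ φ y + ψ x = 0 := by
  let f : ((Fin 4 → ℂ) × (Fin 4 → ℂ)) →ₗ[ℂ] (Fin 7 → ℂ) :=
    LinearMap.pi ![LinearMap.proj 0 ∘ₗ P ∘ₗ LinearMap.fst ℂ _ _,
      LinearMap.proj 1 ∘ₗ P ∘ₗ LinearMap.fst ℂ _ _,
      LinearMap.proj 2 ∘ₗ LinearMap.snd ℂ _ _, LinearMap.proj 3 ∘ₗ LinearMap.snd ℂ _ _,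
      LinearMap.proj 0 ∘ₗ Q ∘ₗ (LinearMap.fst ℂ _ _ - LinearMap.snd ℂ _ _),
      LinearMap.proj 1 ∘ₗ Q ∘ₗ (LinearMap.fst ℂ _ _ - LinearMap.snd ℂ _ _),
      φ ∘ₗ LinearMap.fst ℂ _ _ + ψ ∘ₗ LinearMap.snd ℂ _ _]
  obtain ⟨⟨y, x⟩, hf, hne⟩ :=
    (Submodule.ne_bot_iff _).mp (LinearMap.ker_ne_bot_of_finrank_lt (f := f) (by simp))
  have hf' := fun i => congrFun (LinearMap.mem_ker.mp hf) i
  have e₀ : P y 0 = 0 := hf' 0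
  have e₁ : P y 1 = 0 := hf' 1
  have e₂ : x 2 = 0 := hf' 2
  have e₃ : x 3 = 0 := hf' 3
  have e₄ : Q (y - x) 0 = 0 := hf' 4
  have e₅ : Q (y - x) 1 = 0 := hf' 5
  have e₆ : φ y + ψ x = 0 := hf' 6
  have hy : y ≠ 0 := by
    rintro rfl
    have hx : x ≠ 0 := by
      rintro rfl
      exact hne rfl
    have h1 := signedQuad_one_neg (h.right.ne_zero (0 - x) (by simpa using hx)) e₄ e₅
    have h2 := signedQuad_one_pos (v := 0 - x) (by simpa using hx) (by simp [e₂]) (by simp [e₃])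
    rw [h.right.quad] at h1
    linarith
  by_cases hx : x = 0
  · subst hx
    obtain ⟨x, hne, x₂, x₃, hψ⟩ := exists_positive_vector ψ
    refine ⟨x, y, 0, hne, x₂, x₃, hy, e₀, e₁, ?_⟩
    simp only [zero_smul, zero_add, one_smul, sub_zero, map_zero, add_zero, hψ] at *
    exact ⟨hy, e₄, e₅, e₆⟩
  · refine ⟨x, y, -1, hx, e₂, e₃, hy, e₀, e₁, ?_⟩
    rw [show (-1 : ℂ) • x + (1 : ℂ) • y = y - x by module]
    refine ⟨fun hxy => ?_, e₄, e₅, e₆⟩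
    rw [sub_eq_zero] at hxy
    subst hxy
    have h1 := signedQuad_one_neg (h.left.ne_zero y hy) e₀ e₁
    have h2 := signedQuad_one_pos hy e₂ e₃
    rw [h.left.quad] at h1
    linarith

/-- The interlacing inequality produced by one linear condition `φ y + ψ x = 0`. -/
lemma mixed_le (h : IsFormSum a b c P Q) (hb : b 1 ≤ b 0)
    (hb' : b 2 < b 1) (hb'' : b 3 ≤ b 2) (φ ψ : (Fin 4 → ℂ) →ₗ[ℂ] ℂ)
    {mA MA mC MC : ℝ}
    (hC : ∀ x y, φ y + ψ x = 0 → x 2 = 0 → x 3 = 0 →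
      signedQuad c x ≤ MC * signedQuad 1 x ∧
      mC * signedQuad 1 (orthPart x y) ≤ signedQuad c (orthPart x y))
    (hA : ∀ x y, φ y + ψ x = 0 → P y 0 = 0 → P y 1 = 0 →
      signedQuad a (P y) ≤ mA * signedQuad 1 (P y) ∧
      MA * signedQuad 1 (orthPart (P y) (P x)) ≤ signedQuad a (orthPart (P y) (P x))) :
    mA + MA + b 3 + b 1 ≤ MC + mC := by
  obtain ⟨x, y, s, hx, x₂, x₃, hy, y₀, y₁, hz, z₀, z₁, hφ⟩ := h.exists_signature_plane φ ψ
  have qy := signedQuad_one_neg (h.left.ne_zero y hy) y₀ y₁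
  have qz := signedQuad_one_neg (h.right.ne_zero _ hz) z₀ z₁
  rw [h.left.quad] at qy
  rw [h.right.quad] at qz
  exact h.trace_le one_ne_zero (signedQuad_one_pos hx x₂ x₃) qy qz (hC x y hφ x₂ x₃).1
    (hC x y hφ x₂ x₃).2 (hA x y hφ y₀ y₁).1 (hA x y hφ y₀ y₁).2
    (signedQuad_le (.inl z₀) (.inl z₁) (.inr hb'') (.inr le_rfl))
    (le_signedQuad (.inr hb) (.inr le_rfl) (.inr hb'.le) (.inr (by linarith)))

lemma mixed_inequalities (h : IsFormSum a b c P Q) (ha : a 1 ≤ a 0) (ha' : a 2 < a 1)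
    (ha'' : a 3 ≤ a 2) (hb : b 1 ≤ b 0) (hb' : b 2 < b 1) (hb'' : b 3 ≤ b 2) (hc : c 1 ≤ c 0)
    (hc' : c 2 < c 1) (hc'' : c 3 ≤ c 2) :
    a 3 + a 1 + b 3 + b 1 ≤ c 0 + c 3 ∧ a 3 + a 1 + b 3 + b 1 ≤ c 1 + c 2 ∧
      a 3 + a 0 + b 3 + b 1 ≤ c 0 + c 2 ∧ a 2 + a 1 + b 3 + b 1 ≤ c 0 + c 2 := by
  refine ⟨h.mixed_le hb hb' hb'' (LinearMap.proj 2) 0 (fun x y hφ x₂ x₃ => ?_)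
      (fun x y _ y₀ y₁ => ?_),
    h.mixed_le hb hb' hb'' 0 (LinearMap.proj 0) (fun x y hφ x₂ x₃ => ?_)
      (fun x y _ y₀ y₁ => ?_),
    h.mixed_le hb hb' hb'' 0 (LinearMap.proj 1 ∘ₗ P) (fun x y hφ x₂ x₃ => ?_)
      (fun x y hφ y₀ y₁ => ?_),
    h.mixed_le hb hb' hb'' (LinearMap.proj 3 ∘ₗ P) 0 (fun x y hφ x₂ x₃ => ?_)
      (fun x y hφ y₀ y₁ => ?_)⟩
  · have y₂ : y 2 = 0 := by simpa using hφ
    exact ⟨signedQuad_le (.inr le_rfl) (.inr hc) (.inl x₂) (.inl x₃),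
      le_signedQuad (.inr (by linarith)) (.inr (by linarith))
        (.inl (orthPart_apply_eq_zero x₂ y₂)) (.inr le_rfl)⟩
  · exact ⟨signedQuad_le (.inl y₀) (.inl y₁) (.inr ha'') (.inr le_rfl),
      le_signedQuad (.inr ha) (.inr le_rfl) (.inr ha'.le) (.inr (by linarith))⟩
  · have x₀ : x 0 = 0 := by simpa using hφ
    exact ⟨signedQuad_le (.inl x₀) (.inr le_rfl) (.inl x₂) (.inl x₃),
      le_signedQuad (.inr (by linarith)) (.inr (by linarith)) (.inr le_rfl) (.inr hc'')⟩
  · exact ⟨signedQuad_le (.inl y₀) (.inl y₁) (.inr ha'') (.inr le_rfl),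
      le_signedQuad (.inr ha) (.inr le_rfl) (.inr ha'.le) (.inr (by linarith))⟩
  · exact ⟨signedQuad_le (.inr le_rfl) (.inr hc) (.inl x₂) (.inl x₃),
      le_signedQuad (.inr (by linarith)) (.inr (by linarith)) (.inr le_rfl) (.inr hc'')⟩
  · have x₁ : P x 1 = 0 := by simpa using hφ
    exact ⟨signedQuad_le (.inl y₀) (.inl y₁) (.inr ha'') (.inr le_rfl),
      le_signedQuad (.inr le_rfl) (.inl (orthPart_apply_eq_zero y₁ x₁)) (.inr (by linarith))
        (.inr (by linarith))⟩
  · exact ⟨signedQuad_le (.inr le_rfl) (.inr hc) (.inl x₂) (.inl x₃),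
      le_signedQuad (.inr (by linarith)) (.inr (by linarith)) (.inr le_rfl) (.inr hc'')⟩
  · have y₃ : P y 3 = 0 := by simpa using hφ
    exact ⟨signedQuad_le (.inl y₀) (.inl y₁) (.inr le_rfl) (.inl y₃),
      le_signedQuad (.inr ha) (.inr le_rfl) (.inr ha'.le) (.inr (by linarith))⟩

lemma pos_quad_le (h : IsFormSum a b c P Q) {x : Fin 4 → ℂ} {A B C : ℝ}
    (hx : 0 < signedQuad 1 x) (hA : A * signedQuad 1 (P x) ≤ signedQuad a (P x))
    (hB : B * signedQuad 1 (Q x) ≤ signedQuad b (Q x))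
    (hC : signedQuad c x ≤ C * signedQuad 1 x) : A + B ≤ C := by
  rw [h.quad] at hC
  rw [h.left.quad] at hA
  rw [h.right.quad] at hB
  refine le_of_mul_le_mul_right ?_ hx
  linarith

lemma neg_quad_le (h : IsFormSum a b c P Q) {x : Fin 4 → ℂ} {A B C : ℝ}
    (hx : signedQuad 1 x < 0) (hA : A * signedQuad 1 (P x) ≤ signedQuad a (P x))
    (hB : B * signedQuad 1 (Q x) ≤ signedQuad b (Q x))
    (hC : signedQuad c x ≤ C * signedQuad 1 x) : C ≤ A + B := by
  rw [h.quad] at hC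
  rw [h.left.quad] at hA
  rw [h.right.quad] at hB
  by_contra hcon
  push Not at hcon
  nlinarith [mul_neg_of_pos_of_neg (sub_pos.mpr hcon) hx]

lemma extremal_inequalities (h : IsFormSum a b c P Q) (ha : a 1 ≤ a 0) (ha' : a 2 < a 1)
    (ha'' : a 3 ≤ a 2) (hb : b 1 ≤ b 0) (hb' : b 2 < b 1) (hb'' : b 3 ≤ b 2) (hc : c 1 ≤ c 0)
    (hc'' : c 3 ≤ c 2) :
    a 1 + b 1 ≤ c 1 ∧ c 2 ≤ a 2 + b 2 ∧ a 0 + b 1 ≤ c 0 ∧ c 3 ≤ a 2 + b 3 := by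
  refine ⟨?_, ?_, ?_, ?_⟩
  · obtain ⟨x, hx, x₂, x₃, x₀⟩ := exists_positive_vector (LinearMap.proj 0)
    exact h.pos_quad_le (signedQuad_one_pos hx x₂ x₃)
      (le_signedQuad (.inr ha) (.inr le_rfl) (.inr ha'.le) (.inr (by linarith)))
      (le_signedQuad (.inr hb) (.inr le_rfl) (.inr hb'.le) (.inr (by linarith)))
      (signedQuad_le (.inl x₀) (.inr le_rfl) (.inl x₂) (.inl x₃))
  · obtain ⟨x, hx, x₀, x₁, x₃⟩ := exists_negative_vector (LinearMap.proj 3)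
    exact h.neg_quad_le (signedQuad_one_neg hx x₀ x₁)
      (le_signedQuad (.inr (by linarith)) (.inr ha'.le) (.inr le_rfl) (.inr ha''))
      (le_signedQuad (.inr (by linarith)) (.inr hb'.le) (.inr le_rfl) (.inr hb''))
      (signedQuad_le (.inl x₀) (.inl x₁) (.inr le_rfl) (.inl x₃))
  · obtain ⟨x, hx, x₂, x₃, x₁⟩ := exists_positive_vector (LinearMap.proj 1 ∘ₗ P)
    exact h.pos_quad_le (signedQuad_one_pos hx x₂ x₃)
      (le_signedQuad (.inr le_rfl) (.inl x₁) (.inr (by linarith)) (.inr (by linarith)))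
      (le_signedQuad (.inr hb) (.inr le_rfl) (.inr hb'.le) (.inr (by linarith)))
      (signedQuad_le (.inr le_rfl) (.inr hc) (.inl x₂) (.inl x₃))
  · obtain ⟨x, hx, x₀, x₁, x₂⟩ := exists_negative_vector (LinearMap.proj 2 ∘ₗ Q)
    exact h.neg_quad_le (signedQuad_one_neg hx x₀ x₁)
      (le_signedQuad (.inr (by linarith)) (.inr ha'.le) (.inr le_rfl) (.inr ha''))
      (le_signedQuad (.inr (by linarith)) (.inr (by linarith)) (.inl x₂) (.inr le_rfl))
      (signedQuad_le (.inl x₀) (.inl x₁) (.inr hc'') (.inr le_rfl))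

end IsFormSum

lemma IsPseudoIsometry.le_gramTrace_single {P : (Fin 4 → ℂ) →ₗ[ℂ] (Fin 4 → ℂ)}
    (hP : IsPseudoIsometry P) {a : Fin 4 → ℝ} (ha : a 1 ≤ a 0) (ha' : a 2 < a 1)
    (ha'' : a 3 ≤ a 2) :
    a 0 + a 1 ≤ gramTrace a (P (Pi.single 0 1)) (P (Pi.single 1 1)) := by
  obtain ⟨u, hu, u₂, u₃, hu₁⟩ := exists_positive_vector (LinearMap.proj 1 ∘ₗ P)
  have hPu : P u 1 = 0 := hu₁
  have hu_eq : u = u 0 • Pi.single 0 1 + u 1 • Pi.single 1 1 := by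
    ext i
    fin_cases i <;> simp [u₂, u₃]
  have hupos := signedQuad_one_pos hu u₂ u₃
  have hdet : gramDet (Pi.single 0 1) (Pi.single 1 1) = 1 := by
    simp [gramDet, signedQuad, signedForm]
  have key (v : Fin 4 → ℂ) (hG : 0 ≤ gramDet u v) :
      (a 0 + a 1) * gramDet u v ≤ gramTrace a (P u) (P v) := by
    rw [← hP.gramDet_map] at hG ⊢
    refine le_gramTrace_of_pos (by rwa [hP.quad]) (mul_le_mul_of_nonneg_left
      (le_signedQuad (.inr le_rfl) (.inl hPu) (.inr (by linarith)) (.inr (by linarith))) hG)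
      (le_signedQuad (.inr ha) (.inr le_rfl) (.inr ha'.le) (.inr (by linarith)))
  by_cases h₁ : u 1 = 0
  · have h₀ : u 0 ≠ 0 := by
      intro h₀
      apply hu
      rw [hu_eq, h₀, h₁]
      simp
    have hn := normSq_pos.mpr h₀
    have hu_eq' : u = u 1 • Pi.single 1 1 + u 0 • Pi.single 0 1 := hu_eq.trans (add_comm _ _)
    have e : gramDet u (Pi.single 1 1) = normSq (u 0) := by
      rw [gramDet_comm]
      conv_lhs => rw [hu_eq']
      rw [gramDet_comb, gramDet_comm, hdet, mul_one]
    have k := key (Pi.single 1 1) (by rw [e]; exact hn.le)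
    have e' : gramTrace a (P u) (P (Pi.single 1 1))
        = normSq (u 0) * gramTrace a (P (Pi.single 0 1)) (P (Pi.single 1 1)) := by
      rw [gramTrace_comm, gramTrace_comm a (P (Pi.single 0 1)), ← gramTrace_comb _ _ _ (u 1),
        ← map_smul, ← map_smul, ← map_add, ← hu_eq']
    rw [e, e'] at k
    refine le_of_mul_le_mul_left ?_ hn
    linarith
  · have hn := normSq_pos.mpr h₁
    have e : gramDet u (Pi.single 0 1) = normSq (u 1) := by
      rw [gramDet_comm]
      conv_lhs => rw [hu_eq]
      rw [gramDet_comb, hdet, mul_one]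
    have k := key (Pi.single 0 1) (by rw [e]; exact hn.le)
    have e' : gramTrace a (P u) (P (Pi.single 0 1))
        = normSq (u 1) * gramTrace a (P (Pi.single 0 1)) (P (Pi.single 1 1)) := by
      rw [gramTrace_comm, ← gramTrace_comb _ _ _ (u 0),
        ← map_smul, ← map_smul, ← map_add, ← hu_eq]
    rw [e, e'] at k
    refine le_of_mul_le_mul_left ?_ hn
    linarith

lemma IsFormSum.add_le_add {a b c : Fin 4 → ℝ} {P Q : (Fin 4 → ℂ) →ₗ[ℂ] (Fin 4 → ℂ)}
    (h : IsFormSum a b c P Q) (ha : a 1 ≤ a 0) (ha' : a 2 < a 1)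
    (ha'' : a 3 ≤ a 2) (hb : b 1 ≤ b 0) (hb' : b 2 < b 1) (hb'' : b 3 ≤ b 2) :
    a 0 + a 1 + (b 0 + b 1) ≤ c 0 + c 1 := by
  have hA := h.left.le_gramTrace_single ha ha' ha''
  have hB := h.right.le_gramTrace_single hb hb' hb''
  have hC := h.gramTrace_eq (Pi.single 0 1) (Pi.single 1 1)
  have : gramTrace c (Pi.single 0 1) (Pi.single 1 1) = c 1 + c 0 := by
    simp [gramTrace, signedQuad, signedForm]
  linarith

lemma Ipq_mul_self (p q : ℕ) : Ipq p q * Ipq p q = 1 := by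
  rw [Ipq, Matrix.diagonal_mul_diagonal, ← Matrix.diagonal_one]
  congr 1
  ext i
  split_ifs <;> simp

lemma Upq_inv {p q : ℕ} {g : Matrix (Fin (p + q)) (Fin (p + q)) ℂ} (hg : g ∈ Upq p q) :
    g⁻¹ = Ipq p q * gᴴ * Ipq p q := by
  apply Matrix.inv_eq_right_inv
  rw [← Matrix.mul_assoc, ← Matrix.mul_assoc, hg.2, Ipq_mul_self]

lemma one_mem_Upq (p q : ℕ) : 1 ∈ Upq p q := by
  simp [Upq]

lemma mul_mem_Upq {p q : ℕ} {g h : Matrix (Fin (p + q)) (Fin (p + q)) ℂ} (hg : g ∈ Upq p q)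
    (hh : h ∈ Upq p q) : g * h ∈ Upq p q := by
  refine ⟨hg.1.mul hh.1, ?_⟩
  calc g * h * Ipq p q * (g * h)ᴴ = g * (h * Ipq p q * hᴴ) * gᴴ := by
        rw [Matrix.conjTranspose_mul]; simp only [Matrix.mul_assoc]
    _ = Ipq p q := by rw [hh.2, hg.2]

/-- The matrix of the Hermitian form attached to `d_x`. -/
noncomputable def signedDiag (p q : ℕ) (x : Fin (p + q) → ℝ) :
    Matrix (Fin (p + q)) (Fin (p + q)) ℂ :=
  Matrix.diagonal (fun i => (x i : ℂ)) * Ipq p q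

lemma dmat_eq (p q : ℕ) (x : Fin (p + q) → ℝ) :
    dmat x = Complex.I • (signedDiag p q x * Ipq p q) := by
  rw [signedDiag, Matrix.mul_assoc, Ipq_mul_self, Matrix.mul_one, dmat, ← Matrix.diagonal_smul]
  rfl

lemma conj_dmat_eq {p q : ℕ} (x : Fin (p + q) → ℝ) {g : Matrix (Fin (p + q)) (Fin (p + q)) ℂ}
    (hg : g ∈ Upq p q) :
    g * dmat x * g⁻¹ = Complex.I • (g * signedDiag p q x * gᴴ * Ipq p q) := by
  rw [Upq_inv hg, dmat_eq, Matrix.mul_smul, Matrix.smul_mul]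
  congr 1
  calc g * (signedDiag p q x * Ipq p q) * (Ipq p q * gᴴ * Ipq p q)
      = g * signedDiag p q x * (Ipq p q * Ipq p q) * gᴴ * Ipq p q := by
        simp only [Matrix.mul_assoc]
    _ = _ := by rw [Ipq_mul_self, Matrix.mul_one]

lemma orbit_subset_add_iff {p q : ℕ} (a b c : Fin (p + q) → ℝ) :
    Orbit p q c ⊆ Orbit p q a + Orbit p q b ↔ ∃ g ∈ Upq p q, ∃ h ∈ Upq p q,
      signedDiag p q c = g * signedDiag p q a * gᴴ + h * signedDiag p q b * hᴴ := by
  constructor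
  · intro hsub
    obtain ⟨A, ⟨g, hg, rfl⟩, B, ⟨h, hh, rfl⟩, hAB⟩ := hsub ⟨1, one_mem_Upq p q, rfl⟩
    refine ⟨g, hg, h, hh, ?_⟩
    simp only [conj_dmat_eq _ hg, conj_dmat_eq _ hh, conj_dmat_eq _ (one_mem_Upq p q)] at hAB
    rw [← smul_add, ← add_mul] at hAB
    have := congrArg (· * Ipq p q) (smul_right_injective _ Complex.I_ne_zero hAB)
    simp only [Matrix.mul_assoc _ (Ipq p q) (Ipq p q), Ipq_mul_self, Matrix.mul_one,
      Matrix.one_mul, Matrix.conjTranspose_one] at this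
    exact this.symm
  · rintro ⟨g, hg, h, hh, hc⟩ _ ⟨u, hu, rfl⟩
    refine Set.mem_add.mpr ⟨_, ⟨u * g, mul_mem_Upq hu hg, rfl⟩, _, ⟨u * h, mul_mem_Upq hu hh, rfl⟩,
      ?_⟩
    rw [conj_dmat_eq _ hu, conj_dmat_eq _ (mul_mem_Upq hu hg), conj_dmat_eq _ (mul_mem_Upq hu hh),
      hc, ← smul_add]
    congr 1
    simp only [Matrix.conjTranspose_mul, Matrix.mul_add, Matrix.add_mul, Matrix.mul_assoc]

lemma signedForm_eq_dotProduct (d : Fin 4 → ℝ) (x y : Fin 4 → ℂ) :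
    signedForm d x y = star x ⬝ᵥ (signedDiag 2 2 d *ᵥ y) := by
  rw [signedDiag, Ipq, Matrix.diagonal_mul_diagonal, dotProduct, Fin.sum_univ_four]
  simp only [Matrix.mulVec_diagonal, signedForm, Pi.star_apply]
  norm_num
  ring

lemma signedForm_conjTranspose_mulVec (d : Fin 4 → ℝ) (g : Matrix (Fin 4) (Fin 4) ℂ)
    (x y : Fin 4 → ℂ) :
    signedForm d (gᴴ *ᵥ x) (gᴴ *ᵥ y)
      = star x ⬝ᵥ ((g * signedDiag 2 2 d * gᴴ : Matrix (Fin 4) (Fin 4) ℂ) *ᵥ y) := by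
  rw [signedForm_eq_dotProduct, Matrix.star_mulVec, Matrix.conjTranspose_conjTranspose,
    ← Matrix.dotProduct_mulVec, Matrix.mulVec_mulVec, Matrix.mulVec_mulVec, Matrix.mul_assoc]

lemma signedDiag_one (p q : ℕ) : signedDiag p q 1 = Ipq p q := by
  simp [signedDiag]

lemma isPseudoIsometry_conjTranspose {g : Matrix (Fin 4) (Fin 4) ℂ} (hg : g ∈ Upq 2 2) :
    IsPseudoIsometry (Matrix.mulVecLin gᴴ) where
  ne_zero x hx h0 := by
    have hinj := Matrix.mulVec_injective_of_isUnit (A := gᴴ)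
      ((Matrix.isUnit_conjTranspose g).mpr hg.1)
    exact hx (hinj (by simpa using h0))
  form x y := by
    simp only [Matrix.mulVecLin_apply]
    rw [signedForm_conjTranspose_mulVec, signedForm_eq_dotProduct, signedDiag_one, hg.2]

lemma exists_isFormSum {a b c : Fin 4 → ℝ}
    (h : Orbit 2 2 c ⊆ Orbit 2 2 a + Orbit 2 2 b) : ∃ P Q, IsFormSum a b c P Q := by
  obtain ⟨g, hg, k, hk, hc⟩ := (orbit_subset_add_iff (p := 2) (q := 2) a b c).mp h
  refine ⟨_, _, isPseudoIsometry_conjTranspose hg, isPseudoIsometry_conjTranspose hk,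
    fun x y => ?_⟩
  simp only [Matrix.mulVecLin_apply]
  rw [signedForm_conjTranspose_mulVec, signedForm_conjTranspose_mulVec, signedForm_eq_dotProduct,
    hc, Matrix.add_mulVec, dotProduct_add]

lemma sum_eq_of_orbit_subset {p q : ℕ} {a b c : Fin (p + q) → ℝ}
    (h : Orbit p q c ⊆ Orbit p q a + Orbit p q b) : ∑ i, a i + ∑ i, b i = ∑ i, c i := by
  obtain ⟨A, ⟨g, hg, rfl⟩, B, ⟨k, hk, rfl⟩, hAB⟩ := h ⟨1, one_mem_Upq p q, rfl⟩
  have tr (x : Fin (p + q) → ℝ) {g : Matrix (Fin (p + q)) (Fin (p + q)) ℂ} (hg : g ∈ Upq p q) :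
      (g * dmat x * g⁻¹).trace = Complex.I * ((∑ i, x i : ℝ) : ℂ) := by
    rw [Matrix.trace_mul_cycle, 
      Matrix.nonsing_inv_mul _ ((Matrix.isUnit_iff_isUnit_det g).mp hg.1), Matrix.one_mul, dmat,
      Matrix.trace_diagonal, ← Finset.mul_sum]
    simp
  have htr := congrArg Matrix.trace hAB
  simp only [Matrix.trace_add, tr _ hg, tr _ hk, tr _ (one_mem_Upq p q), ← mul_add] at htr
  exact_mod_cast mul_left_cancel₀ Complex.I_ne_zero htr

lemma mem_Chol_two_two (x : Fin (2 + 2) → ℝ) :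
    x ∈ Chol 2 2 ↔ x 0 ≥ x 1 ∧ x 1 > x 2 ∧ x 2 ≥ x 3 := by
  constructor
  · rintro ⟨h, h'⟩
    exact ⟨h 0 1 (by decide) (by decide), h' 1 2 (by decide) (by decide),
      h 2 3 (by decide) (by decide)⟩
  · rintro ⟨h, h', h''⟩
    have e₂ : x ⟨2, by decide⟩ = x 2 := rfl
    have e₃ : x ⟨3, by decide⟩ = x 3 := rfl
    refine ⟨fun i j => ?_, fun i j => ?_⟩ <;> fin_cases i <;> fin_cases j <;> norm_num <;>
      linarith

/-- For `u = (W, w, ψ)` with `W` a real `2 × 2` matrix, `w` a column and `ψ` a row, this is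
`det (1 - Wᵀ W)`. -/
def ballDet (u : Fin 8 → ℝ) : ℝ :=
  1 - (u 0 ^ 2 + u 1 ^ 2 + u 2 ^ 2 + u 3 ^ 2) + (u 0 * u 3 - u 1 * u 2) ^ 2

/-- The quadratic form `wᵀ (1 - Wᵀ W) w`. -/
def colForm (u : Fin 8 → ℝ) : ℝ :=
  (1 - u 0 ^ 2 - u 2 ^ 2) * u 4 ^ 2 - 2 * (u 0 * u 1 + u 2 * u 3) * (u 4 * u 5)
    + (1 - u 1 ^ 2 - u 3 ^ 2) * u 5 ^ 2

/-- The quadratic form `ψ (1 - W Wᵀ) ψᵀ`. -/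
def rowForm (u : Fin 8 → ℝ) : ℝ :=
  (1 - u 0 ^ 2 - u 1 ^ 2) * u 6 ^ 2 - 2 * (u 0 * u 2 + u 1 * u 3) * (u 6 * u 7)
    + (1 - u 2 ^ 2 - u 3 ^ 2) * u 7 ^ 2

/-- The triples `(W, w, ψ)` with `W` a strict contraction and `w`, `ψ` nonzero. -/
def ballDomain : Set (Fin 8 → ℝ) :=
  {u | u 0 ^ 2 + u 1 ^ 2 + u 2 ^ 2 + u 3 ^ 2 < 2 ∧ 0 < ballDet u ∧
    0 < u 4 ^ 2 + u 5 ^ 2 ∧ 0 < u 6 ^ 2 + u 7 ^ 2}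

/-- The weight of a triple `(W, w, ψ)` for the spectrum `a`. -/
noncomputable def ballWeight (a : Fin 4 → ℝ) (u : Fin 8 → ℝ) : ℝ :=
  colForm u ^ (-(a 2 - a 3)) * rowForm u ^ (-(a 0 - a 1)) * ballDet u ^ (a 0 - a 3)

/-- The basic semi-invariants of a pair of triples `(W, w, ψ)`. -/
def semiInv (p : (Fin 8 → ℝ) × (Fin 8 → ℝ)) : Fin 16 → ℝ :=
  let u := p.1
  let v := p.2
  let B : ℝ → ℝ → ℝ → ℝ → ℝ := fun r s x y =>
    r * ((u 0 - v 0) * x + (u 1 - v 1) * y) + s * ((u 2 - v 2) * x + (u 3 - v 3) * y)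
  ![u 6 * v 7 - u 7 * v 6, u 7, v 7, u 4 * v 5 - u 5 * v 4, u 4, v 4,
    B (u 6) (u 7) (u 4) (u 5), B (u 6) (u 7) (v 4) (v 5), B (u 6) (u 7) 0 1,
    B (v 6) (v 7) (u 4) (u 5), B (v 6) (v 7) (v 4) (v 5), B (v 6) (v 7) 0 1,
    B 1 0 (u 4) (u 5), B 1 0 (v 4) (v 5), B 1 0 0 1,
    (u 0 - v 0) * (u 3 - v 3) - (u 1 - v 1) * (u 2 - v 2)]

/-- The product of powers of the semi-invariants. -/
noncomputable def semiInvProd (e : Fin 16 → ℝ) (p : (Fin 8 → ℝ) × (Fin 8 → ℝ)) : ℝ :=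
  ∏ k, |semiInv p k| ^ e k

/-- The function to be maximised. -/
noncomputable def objective (e : Fin 16 → ℝ) (a b : Fin 4 → ℝ)
    (p : (Fin 8 → ℝ) × (Fin 8 → ℝ)) : ℝ :=
  semiInvProd e p ^ 2 * (ballWeight a p.1 * ballWeight b p.2)

lemma binary_form_nonneg {A B C : ℝ} (h : 0 ≤ A + C) (h' : B ^ 2 ≤ A * C) (x y : ℝ) :
    0 ≤ A * x ^ 2 - 2 * B * (x * y) + C * y ^ 2 := by
  have hA : 0 ≤ A := by
    by_contra hA
    push Not at hA
    nlinarith [sq_nonneg B]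
  have hC : 0 ≤ C := by
    by_contra hC
    push Not at hC
    nlinarith [sq_nonneg B]
  rcases hA.eq_or_lt with rfl | hA
  · have : B = 0 := by nlinarith [sq_nonneg B]
    subst this
    nlinarith [mul_nonneg hC (sq_nonneg y)]
  · have : 0 ≤ A * (A * x ^ 2 - 2 * B * (x * y) + C * y ^ 2) := by
      nlinarith [sq_nonneg (A * x - B * y), mul_nonneg (sub_nonneg.mpr h') (sq_nonneg y)]
    exact nonneg_of_mul_nonneg_right this hA

lemma det_sq_le {u : Fin 8 → ℝ} (hu : u 0 ^ 2 + u 1 ^ 2 + u 2 ^ 2 + u 3 ^ 2 ≤ 2) :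
    2 * (u 0 * u 3 - u 1 * u 2) ^ 2 ≤ u 0 ^ 2 + u 1 ^ 2 + u 2 ^ 2 + u 3 ^ 2 := by
  set d := u 0 * u 3 - u 1 * u 2
  set τ := u 0 ^ 2 + u 1 ^ 2 + u 2 ^ 2 + u 3 ^ 2
  have h₁ : 2 * d ≤ τ := by nlinarith [sq_nonneg (u 0 - u 3), sq_nonneg (u 1 + u 2)]
  have h₂ : -(2 * d) ≤ τ := by nlinarith [sq_nonneg (u 0 + u 3), sq_nonneg (u 1 - u 2)]
  have h₀ : 0 ≤ τ := by positivity
  have h₃ : 4 * d ^ 2 ≤ τ ^ 2 := by nlinarith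
  nlinarith

lemma ballDet_le_one {u : Fin 8 → ℝ} (hu : u 0 ^ 2 + u 1 ^ 2 + u 2 ^ 2 + u 3 ^ 2 ≤ 2) :
    ballDet u ≤ 1 := by
  have := det_sq_le hu
  rw [ballDet]
  nlinarith [sq_nonneg (u 0 * u 3 - u 1 * u 2)]

lemma ballDet_mul_le_colForm {u : Fin 8 → ℝ}
    (hu : u 0 ^ 2 + u 1 ^ 2 + u 2 ^ 2 + u 3 ^ 2 ≤ 2) (hδ : 0 ≤ ballDet u) :
    ballDet u * (u 4 ^ 2 + u 5 ^ 2) ≤ colForm u := by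
  have hd := det_sq_le hu
  have := binary_form_nonneg (A := 1 - u 0 ^ 2 - u 2 ^ 2 - ballDet u)
    (B := u 0 * u 1 + u 2 * u 3) (C := 1 - u 1 ^ 2 - u 3 ^ 2 - ballDet u)
    (by rw [ballDet]; linarith)
    (by
      have := mul_nonneg hδ (sq_nonneg (u 0 * u 3 - u 1 * u 2))
      rw [ballDet] at *
      linarith) (u 4) (u 5)
  rw [colForm]
  linarith

lemma ballDet_mul_le_rowForm {u : Fin 8 → ℝ}
    (hu : u 0 ^ 2 + u 1 ^ 2 + u 2 ^ 2 + u 3 ^ 2 ≤ 2) (hδ : 0 ≤ ballDet u) :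
    ballDet u * (u 6 ^ 2 + u 7 ^ 2) ≤ rowForm u := by
  have hd := det_sq_le hu
  have := binary_form_nonneg (A := 1 - u 0 ^ 2 - u 1 ^ 2 - ballDet u)
    (B := u 0 * u 2 + u 1 * u 3) (C := 1 - u 2 ^ 2 - u 3 ^ 2 - ballDet u)
    (by rw [ballDet]; linarith)
    (by
      have := mul_nonneg hδ (sq_nonneg (u 0 * u 3 - u 1 * u 2))
      rw [ballDet] at *
      linarith) (u 6) (u 7)
  rw [rowForm]
  linarith

lemma colForm_pos {u : Fin 8 → ℝ} (hu : u ∈ ballDomain) : 0 < colForm u :=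
  (mul_pos hu.2.1 hu.2.2.1).trans_le (ballDet_mul_le_colForm hu.1.le hu.2.1.le)

lemma rowForm_pos {u : Fin 8 → ℝ} (hu : u ∈ ballDomain) : 0 < rowForm u :=
  (mul_pos hu.2.1 hu.2.2.2).trans_le (ballDet_mul_le_rowForm hu.1.le hu.2.1.le)

lemma ballWeight_pos (a : Fin 4 → ℝ) {u : Fin 8 → ℝ} (hu : u ∈ ballDomain) :
    0 < ballWeight a u :=
  mul_pos (mul_pos (Real.rpow_pos_of_pos (colForm_pos hu) _)
    (Real.rpow_pos_of_pos (rowForm_pos hu) _)) (Real.rpow_pos_of_pos hu.2.1 _)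

/-- The triples `(W, w, ψ)` with `W` of Frobenius norm at most `√2` and `w`, `ψ` of norm one. -/
def unitDomain : Set (Fin 8 → ℝ) :=
  {u | u 0 ^ 2 + u 1 ^ 2 + u 2 ^ 2 + u 3 ^ 2 ≤ 2 ∧ u 4 ^ 2 + u 5 ^ 2 = 1 ∧
    u 6 ^ 2 + u 7 ^ 2 = 1}

lemma mem_ballDomain {u : Fin 8 → ℝ} (hu : u ∈ unitDomain) (hδ : 0 < ballDet u) :
    u ∈ ballDomain := by
  refine ⟨?_, hδ, by rw [hu.2.1]; exact one_pos, by rw [hu.2.2]; exact one_pos⟩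
  have := det_sq_le hu.1
  have := hu.1
  rw [ballDet] at hδ
  linarith

lemma isCompact_unitDomain : IsCompact unitDomain := by
  apply Metric.isCompact_of_isClosed_isBounded
  · refine IsClosed.and (isClosed_le (by fun_prop) (by fun_prop))
      (IsClosed.and (isClosed_eq (by fun_prop) (by fun_prop))
        (isClosed_eq (by fun_prop) (by fun_prop)))
  · refine (Metric.isBounded_closedBall (x := (0 : Fin 8 → ℝ)) (r := 2)).subset fun u hu => ?_
    rw [mem_closedBall_zero_iff, pi_norm_le_iff_of_nonneg (by norm_num)]
    obtain ⟨h₁, h₂, h₃⟩ := hu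
    intro i
    rw [Real.norm_eq_abs]
    apply abs_le_of_sq_le_sq _ (by norm_num)
    have hs := fun i => sq_nonneg (u i)
    have := hs 0
    have := hs 1
    have := hs 2
    have := hs 3
    have := hs 4
    have := hs 5
    have := hs 6
    have := hs 7
    fin_cases i <;> simp only [Fin.reduceFinMk, Fin.zero_eta, Fin.mk_one] <;> nlinarith

lemma ballWeight_le {a : Fin 4 → ℝ} (ha : a 1 ≤ a 0) (ha' : a 3 ≤ a 2) {u : Fin 8 → ℝ}
    (hu : u ∈ unitDomain) (hδ : 0 < ballDet u) : ballWeight a u ≤ ballDet u ^ (a 1 - a 2) := by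
  have h₁ := ballDet_mul_le_colForm hu.1 hδ.le
  have h₂ := ballDet_mul_le_rowForm hu.1 hδ.le
  rw [hu.2.1, mul_one] at h₁
  rw [hu.2.2, mul_one] at h₂
  have e₁ := Real.rpow_le_rpow_of_nonpos hδ h₁ (z := -(a 2 - a 3)) (by linarith)
  have e₂ := Real.rpow_le_rpow_of_nonpos hδ h₂ (z := -(a 0 - a 1)) (by linarith)
  have := Real.rpow_nonneg (hδ.le.trans h₂) (-(a 0 - a 1))
  have : ballDet u ^ (a 1 - a 2) = ballDet u ^ (-(a 2 - a 3)) * ballDet u ^ (-(a 0 - a 1))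
      * ballDet u ^ (a 0 - a 3) := by
    rw [← Real.rpow_add hδ, ← Real.rpow_add hδ]
    congr 1
    ring
  rw [this, ballWeight]
  gcongr

lemma continuous_semiInv (k : Fin 16) : Continuous fun p => semiInv p k := by
  fin_cases k <;> simp [semiInv] <;> fun_prop

lemma continuous_semiInvProd {e : Fin 16 → ℝ} (he : ∀ k, 0 ≤ e k) :
    Continuous (semiInvProd e) :=
  continuous_finsetProd _ fun k _ =>
    (continuous_semiInv k).abs.rpow_const fun _ => Or.inr (he k)

lemma continuousOn_ballWeight (a : Fin 4 → ℝ) : ContinuousOn (ballWeight a) ballDomain := by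
  have h₁ : Continuous colForm := by unfold colForm; fun_prop
  have h₂ : Continuous rowForm := by unfold rowForm; fun_prop
  have h₃ : Continuous ballDet := by unfold ballDet; fun_prop
  exact ((h₁.continuousOn.rpow_const fun u hu => .inl (colForm_pos hu).ne').mul
    (h₂.continuousOn.rpow_const fun u hu => .inl (rowForm_pos hu).ne')).mul
    (h₃.continuousOn.rpow_const fun u hu => .inl hu.2.1.ne')

lemma semiInvProd_nonneg (e : Fin 16 → ℝ) (p : (Fin 8 → ℝ) × (Fin 8 → ℝ)) :
    0 ≤ semiInvProd e p :=
  Finset.prod_nonneg fun _ _ => Real.rpow_nonneg (abs_nonneg _) _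

/-- A pair of triples at which no semi-invariant vanishes. -/
noncomputable def basePoint : (Fin 8 → ℝ) × (Fin 8 → ℝ) :=
  (![1 / 10, 1 / 10, 1 / 10, 1 / 5, 3 / 5, 4 / 5, 3 / 5, 4 / 5],
    ![0, 0, 0, 0, 4 / 5, 3 / 5, 4 / 5, 3 / 5])

lemma semiInvProd_basePoint_pos (e : Fin 16 → ℝ) : 0 < semiInvProd e basePoint := by
  refine Finset.prod_pos fun k _ => Real.rpow_pos_of_pos (abs_pos.mpr ?_) _
  fin_cases k <;> simp [semiInv, basePoint] <;> norm_num

lemma basePoint_mem : basePoint.1 ∈ unitDomain ∧ basePoint.2 ∈ unitDomain := by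
  constructor <;> (simp [unitDomain, basePoint]; norm_num)

lemma ballDet_basePoint_pos : 0 < ballDet basePoint.1 ∧ 0 < ballDet basePoint.2 := by
  constructor
  · simp [ballDet, basePoint]; norm_num
  · simp [ballDet, basePoint]

lemma exists_pos_mul_rpow_le {C F s : ℝ} (hC : 0 < C) (hF : 0 < F) (hs : 0 < s) :
    ∃ ε, 0 < ε ∧ ∀ x, 0 < x → x < ε → C * x ^ s ≤ F := by
  refine ⟨(F / C) ^ s⁻¹, by positivity, fun x hx hxε => ?_⟩
  have h := Real.rpow_le_rpow hx.le hxε.le hs.le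
  rw [Real.rpow_inv_rpow (by positivity) hs.ne', le_div_iff₀ hC] at h
  linarith

lemma exists_unit_maximizer {e : Fin 16 → ℝ} (he : ∀ k, 0 ≤ e k) {a b : Fin 4 → ℝ}
    (ha : a 1 ≤ a 0) (ha' : a 2 < a 1) (ha'' : a 3 ≤ a 2)
    (hb : b 1 ≤ b 0) (hb' : b 2 < b 1) (hb'' : b 3 ≤ b 2) :
    ∃ p, p.1 ∈ ballDomain ∧ p.2 ∈ ballDomain ∧ 0 < objective e a b p ∧
      ∀ p' : (Fin 8 → ℝ) × (Fin 8 → ℝ), p'.1 ∈ unitDomain → p'.2 ∈ unitDomain →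
        0 < ballDet p'.1 → 0 < ballDet p'.2 → objective e a b p' ≤ objective e a b p := by
  obtain ⟨C, hC⟩ := (isCompact_unitDomain.prod isCompact_unitDomain).exists_bound_of_continuousOn
    (continuous_semiInvProd he).continuousOn
  have hF : 0 < objective e a b basePoint := mul_pos (pow_pos (semiInvProd_basePoint_pos e) 2)
    (mul_pos (ballWeight_pos a (mem_ballDomain basePoint_mem.1 ballDet_basePoint_pos.1))
      (ballWeight_pos b (mem_ballDomain basePoint_mem.2 ballDet_basePoint_pos.2)))
  have hCpos : 0 < C ^ 2 := by
    have h := hC basePoint ⟨basePoint_mem.1, basePoint_mem.2⟩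
    rw [Real.norm_eq_abs, abs_of_pos (semiInvProd_basePoint_pos e)] at h
    exact pow_pos ((semiInvProd_basePoint_pos e).trans_le h) 2
  have hbound (p : (Fin 8 → ℝ) × (Fin 8 → ℝ)) (h₁ : p.1 ∈ unitDomain) (h₂ : p.2 ∈ unitDomain)
      (h₃ : 0 < ballDet p.1) (h₄ : 0 < ballDet p.2) :
      objective e a b p ≤ C ^ 2 * ballDet p.1 ^ (a 1 - a 2) ∧
        objective e a b p ≤ C ^ 2 * ballDet p.2 ^ (b 1 - b 2) := by
    have hS : semiInvProd e p ^ 2 ≤ C ^ 2 := by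
      have h := hC p ⟨h₁, h₂⟩
      rw [Real.norm_eq_abs, abs_of_nonneg (semiInvProd_nonneg e p)] at h
      exact pow_le_pow_left₀ (semiInvProd_nonneg e p) h 2
    have wA := ballWeight_le ha ha'' h₁ h₃
    have wB := ballWeight_le hb hb'' h₂ h₄
    have pA := (ballWeight_pos a (mem_ballDomain h₁ h₃)).le
    have pB := (ballWeight_pos b (mem_ballDomain h₂ h₄)).le
    have oA := Real.rpow_le_one h₃.le (ballDet_le_one h₁.1) (z := a 1 - a 2) (by linarith)
    have oB := Real.rpow_le_one h₄.le (ballDet_le_one h₂.1) (z := b 1 - b 2) (by linarith)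
    constructor
    · refine mul_le_mul hS ?_ (mul_nonneg pA pB) hCpos.le
      nlinarith
    · refine mul_le_mul hS ?_ (mul_nonneg pA pB) hCpos.le
      nlinarith
  obtain ⟨εA, hεA, hA⟩ := exists_pos_mul_rpow_le hCpos hF (sub_pos.mpr ha')
  obtain ⟨εB, hεB, hB⟩ := exists_pos_mul_rpow_le hCpos hF (sub_pos.mpr hb')
  set ηA := min εA (ballDet basePoint.1)
  set ηB := min εB (ballDet basePoint.2)
  have hηA : 0 < ηA := lt_min hεA ballDet_basePoint_pos.1
  have hηB : 0 < ηB := lt_min hεB ballDet_basePoint_pos.2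
  have hcont : Continuous ballDet := by unfold ballDet; fun_prop
  have hK : IsCompact {p : (Fin 8 → ℝ) × (Fin 8 → ℝ) | p ∈ unitDomain ×ˢ unitDomain ∧
      ηA ≤ ballDet p.1 ∧ ηB ≤ ballDet p.2} :=
    (isCompact_unitDomain.prod isCompact_unitDomain).inter_right
      ((isClosed_le continuous_const (hcont.comp continuous_fst)).inter
        (isClosed_le continuous_const (hcont.comp continuous_snd)))
  have hdom : ∀ p ∈ {p : (Fin 8 → ℝ) × (Fin 8 → ℝ) | p ∈ unitDomain ×ˢ unitDomain ∧
      ηA ≤ ballDet p.1 ∧ ηB ≤ ballDet p.2}, p.1 ∈ ballDomain ∧ p.2 ∈ ballDomain :=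
    fun p hp => ⟨mem_ballDomain hp.1.1 (hηA.trans_le hp.2.1),
      mem_ballDomain hp.1.2 (hηB.trans_le hp.2.2)⟩
  have hbase : basePoint ∈ {p : (Fin 8 → ℝ) × (Fin 8 → ℝ) | p ∈ unitDomain ×ˢ unitDomain ∧
      ηA ≤ ballDet p.1 ∧ ηB ≤ ballDet p.2} :=
    ⟨⟨basePoint_mem.1, basePoint_mem.2⟩, min_le_right _ _, min_le_right _ _⟩
  obtain ⟨p, hpK, hmax⟩ := hK.exists_isMaxOn ⟨basePoint, hbase⟩ (f := objective e a b)
    (((continuous_semiInvProd he).pow 2).continuousOn.mul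
      (((continuousOn_ballWeight a).comp continuousOn_fst fun p hp => (hdom p hp).1).mul
        ((continuousOn_ballWeight b).comp continuousOn_snd fun p hp => (hdom p hp).2)))
  have hp₀ : objective e a b basePoint ≤ objective e a b p := hmax hbase
  refine ⟨p, (hdom p hpK).1, (hdom p hpK).2, hF.trans_le hp₀, fun p' h₁ h₂ h₃ h₄ => ?_⟩
  by_cases hlA : ηA ≤ ballDet p'.1
  · by_cases hlB : ηB ≤ ballDet p'.2
    · exact hmax ⟨⟨h₁, h₂⟩, hlA, hlB⟩
    · push Not at hlB
      exact ((hbound p' h₁ h₂ h₃ h₄).2.trans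
        (hB _ h₄ (hlB.trans_le (min_le_left _ _)))).trans hp₀
  · push Not at hlA
    exact ((hbound p' h₁ h₂ h₃ h₄).1.trans
      (hA _ h₃ (hlA.trans_le (min_le_left _ _)))).trans hp₀

/-- Rescaling of the vectors `w` and `ψ`. -/
def rescale (s t : ℝ) (u : Fin 8 → ℝ) : Fin 8 → ℝ :=
  ![u 0, u 1, u 2, u 3, s * u 4, s * u 5, t * u 6, t * u 7]

lemma ballDet_rescale (s t : ℝ) (u : Fin 8 → ℝ) : ballDet (rescale s t u) = ballDet u := by
  simp [ballDet, rescale]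

lemma ballWeight_rescale {s t : ℝ} (hs : 0 < s) (ht : 0 < t) (a : Fin 4 → ℝ) {u : Fin 8 → ℝ}
    (hu : u ∈ ballDomain) :
    ballWeight a (rescale s t u)
      = (s ^ (a 2 - a 3) * t ^ (a 0 - a 1)) ^ (-2 : ℝ) * ballWeight a u := by
  have h₁ : colForm (rescale s t u) = s ^ (2 : ℝ) * colForm u := by
    simp [colForm, rescale]
    ring
  have h₂ : rowForm (rescale s t u) = t ^ (2 : ℝ) * rowForm u := by
    simp [rowForm, rescale]
    ring
  rw [ballWeight, ballWeight, ballDet_rescale, h₁, h₂,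
    Real.mul_rpow (by positivity) (colForm_pos hu).le,
    Real.mul_rpow (by positivity) (rowForm_pos hu).le,
    Real.mul_rpow (by positivity) (by positivity), ← Real.rpow_mul hs.le, ← Real.rpow_mul ht.le,
    ← Real.rpow_mul hs.le, ← Real.rpow_mul ht.le,
    show 2 * -(a 2 - a 3) = (a 2 - a 3) * -2 by ring,
    show 2 * -(a 0 - a 1) = (a 0 - a 1) * -2 by ring]
  ring

lemma semiInvProd_of_scale {κ : Fin 16 → ℝ} (hκ : ∀ k, 0 < κ k) (e : Fin 16 → ℝ)
    {p p' : (Fin 8 → ℝ) × (Fin 8 → ℝ)} (h : ∀ k, semiInv p' k = κ k * semiInv p k) :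
    semiInvProd e p' = Real.exp (∑ k, e k * Real.log (κ k)) * semiInvProd e p := by
  rw [Real.exp_sum, semiInvProd, semiInvProd, ← Finset.prod_mul_distrib]
  refine Finset.prod_congr rfl fun k _ => ?_
  rw [h, abs_mul, abs_of_pos (hκ k), Real.mul_rpow (hκ k).le (abs_nonneg _),
    Real.rpow_def_of_pos (hκ k), mul_comm (e k)]

/-- The exponents `e` give a product of semi-invariants with the homogeneity of `a` and `b`. -/
structure IsHomogeneous (e : Fin 16 → ℝ) (a b : Fin 4 → ℝ) : Prop where
  row_left : a 0 - a 1 = e 0 + e 1 + e 6 + e 7 + e 8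
  row_right : b 0 - b 1 = e 0 + e 2 + e 9 + e 10 + e 11
  col_left : a 2 - a 3 = e 3 + e 4 + e 6 + e 9 + e 12
  col_right : b 2 - b 3 = e 3 + e 5 + e 7 + e 10 + e 13

lemma sum_fin_sixteen (f : Fin 16 → ℝ) : ∑ k, f k = f 0 + f 1 + f 2 + f 3 + f 4 + f 5 + f 6 + f 7
    + f 8 + f 9 + f 10 + f 11 + f 12 + f 13 + f 14 + f 15 := by
  simp only [Fin.sum_univ_succ, Fin.sum_univ_zero]
  simp [← add_assoc]

lemma objective_rescale {e : Fin 16 → ℝ} {a b : Fin 4 → ℝ} (he : IsHomogeneous e a b)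
    {p : (Fin 8 → ℝ) × (Fin 8 → ℝ)} (h₁ : p.1 ∈ ballDomain) (h₂ : p.2 ∈ ballDomain)
    {s t s' t' : ℝ} (hs : 0 < s) (ht : 0 < t) (hs' : 0 < s') (ht' : 0 < t') :
    objective e a b (rescale s t p.1, rescale s' t' p.2) = objective e a b p := by
  have hscale := semiInvProd_of_scale
    (κ := ![t * t', t, t', s * s', s, s', t * s, t * s', t, t' * s, t' * s', t', s, s', 1, 1])
    (by intro k; fin_cases k <;> simp <;> positivity) e (p := p)
    (p' := (rescale s t p.1, rescale s' t' p.2))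
    (by intro k; fin_cases k <;> simp [semiInv, rescale] <;> ring)
  have hsum : (∑ k, e k * Real.log (![t * t', t, t', s * s', s, s', t * s, t * s', t, t' * s,
      t' * s', t', s, s', 1, 1] k)) = (a 2 - a 3) * Real.log s + (a 0 - a 1) * Real.log t
        + ((b 2 - b 3) * Real.log s' + (b 0 - b 1) * Real.log t') := by
    rw [sum_fin_sixteen, he.row_left, he.row_right, he.col_left, he.col_right]
    simp [Real.log_mul, hs.ne', ht.ne', hs'.ne', ht'.ne']
    ring
  rw [objective, objective, hscale, hsum, ballWeight_rescale hs ht a h₁,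
    ballWeight_rescale hs' ht' b h₂]
  have hexp : ∀ {s t : ℝ} (x y : ℝ), 0 < s → 0 < t →
      (s ^ x * t ^ y) ^ (-2 : ℝ) = Real.exp (-2 * (x * Real.log s + y * Real.log t)) := by
    intro s t x y hs ht
    rw [Real.rpow_def_of_pos hs, Real.rpow_def_of_pos ht, ← Real.exp_add, ← Real.exp_mul]
    congr 1
    ring
  rw [hexp _ _ hs ht, hexp _ _ hs' ht', Real.exp_add, mul_pow, mul_pow, ← Real.exp_nat_mul,
    ← Real.exp_nat_mul]
  simp only [Nat.cast_ofNat, neg_mul, Real.exp_neg]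
  field_simp

lemma rescale_mem_unitDomain {u : Fin 8 → ℝ} (hu : u ∈ ballDomain) :
    rescale (√(u 4 ^ 2 + u 5 ^ 2))⁻¹ (√(u 6 ^ 2 + u 7 ^ 2))⁻¹ u ∈ unitDomain := by
  have h₁ : (√(u 4 ^ 2 + u 5 ^ 2)) ^ 2 = u 4 ^ 2 + u 5 ^ 2 := Real.sq_sqrt hu.2.2.1.le
  have h₂ : (√(u 6 ^ 2 + u 7 ^ 2)) ^ 2 = u 6 ^ 2 + u 7 ^ 2 := Real.sq_sqrt hu.2.2.2.le
  refine ⟨by simpa [rescale] using hu.1.le, ?_, ?_⟩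
  · simp only [rescale, Matrix.cons_val]
    rw [mul_pow, mul_pow, inv_pow, h₁, ← mul_add, inv_mul_cancel₀ hu.2.2.1.ne']
  · simp only [rescale, Matrix.cons_val]
    rw [mul_pow, mul_pow, inv_pow, h₂, ← mul_add, inv_mul_cancel₀ hu.2.2.2.ne']

lemma exists_maximizer {e : Fin 16 → ℝ} (he : ∀ k, 0 ≤ e k) {a b : Fin 4 → ℝ}
    (hom : IsHomogeneous e a b) (ha : a 1 ≤ a 0) (ha' : a 2 < a 1) (ha'' : a 3 ≤ a 2)
    (hb : b 1 ≤ b 0) (hb' : b 2 < b 1) (hb'' : b 3 ≤ b 2) :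
    ∃ p, p.1 ∈ ballDomain ∧ p.2 ∈ ballDomain ∧ 0 < objective e a b p ∧
      ∀ p' : (Fin 8 → ℝ) × (Fin 8 → ℝ), p'.1 ∈ ballDomain → p'.2 ∈ ballDomain →
        objective e a b p' ≤ objective e a b p := by
  obtain ⟨p, h₁, h₂, h₃, hmax⟩ := exists_unit_maximizer he ha ha' ha'' hb hb' hb''
  refine ⟨p, h₁, h₂, h₃, fun p' h₁' h₂' => ?_⟩
  rw [← objective_rescale hom h₁' h₂' (inv_pos.mpr (Real.sqrt_pos.mpr h₁'.2.2.1))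
    (inv_pos.mpr (Real.sqrt_pos.mpr h₁'.2.2.2)) (inv_pos.mpr (Real.sqrt_pos.mpr h₂'.2.2.1))
    (inv_pos.mpr (Real.sqrt_pos.mpr h₂'.2.2.2))]
  exact hmax _ (rescale_mem_unitDomain h₁') (rescale_mem_unitDomain h₂')
    (by rw [ballDet_rescale]; exact h₁'.2.1) (by rw [ballDet_rescale]; exact h₂'.2.1)

/-- The tangent vector at `(W, w, ψ)` of the action of the group generated by lower triangular
row and column operations and translations of `W`. -/
def tangent (x : Fin 10 → ℝ) (u : Fin 8 → ℝ) : Fin 8 → ℝ :=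
  ![x 0 * u 0 + (u 0 * x 3 + u 1 * x 4) + x 6, x 0 * u 1 + u 1 * x 5 + x 7,
    x 1 * u 0 + x 2 * u 2 + (u 2 * x 3 + u 3 * x 4) + x 8,
    x 1 * u 1 + x 2 * u 3 + u 3 * x 5 + x 9,
    x 5 * u 4, x 3 * u 5 - x 4 * u 4, x 2 * u 6 - x 1 * u 7, x 0 * u 7]

/-- The pairing of the coefficients in `tangent` with a symmetric matrix. -/
def tangentPairing (x : Fin 10 → ℝ) (M : Fin 4 → Fin 4 → ℝ) : ℝ :=
  x 0 * M 0 0 + x 1 * M 0 1 + x 2 * M 1 1 + (x 3 * M 2 2 + x 4 * M 2 3 + x 5 * M 3 3)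
    + (x 6 * M 0 2 + x 7 * M 0 3 + x 8 * M 1 2 + x 9 * M 1 3)

/-- The vector `(W w, w)`. -/
def colVec (u : Fin 8 → ℝ) : Fin 4 → ℝ :=
  ![u 0 * u 4 + u 1 * u 5, u 2 * u 4 + u 3 * u 5, u 4, u 5]

/-- The vector `(ψᵀ, Wᵀ ψᵀ)`. -/
def rowVec (u : Fin 8 → ℝ) : Fin 4 → ℝ :=
  ![u 6, u 7, u 0 * u 6 + u 2 * u 7, u 1 * u 6 + u 3 * u 7]

/-- The matrix `Y adj(1 - Wᵀ W) Yᵀ` where `Y` is the block column `(W, 1)`. -/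
def graphMatrix (u : Fin 8 → ℝ) (i j : Fin 4) : ℝ :=
  let Y : Fin 4 → Fin 2 → ℝ := ![![u 0, u 1], ![u 2, u 3], ![1, 0], ![0, 1]]
  (1 - u 1 ^ 2 - u 3 ^ 2) * (Y i 0 * Y j 0)
    + (u 0 * u 1 + u 2 * u 3) * (Y i 0 * Y j 1 + Y i 1 * Y j 0)
    + (1 - u 0 ^ 2 - u 2 ^ 2) * (Y i 1 * Y j 1)

lemma hasDerivAt_line (u v : Fin 8 → ℝ) (i : Fin 8) :
    HasDerivAt (fun t : ℝ => (u + t • v) i) (v i) 0 := by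
  simpa using ((hasDerivAt_id (0 : ℝ)).mul_const (v i)).const_add (u i)

lemma hasDerivAt_colForm (x : Fin 10 → ℝ) (u : Fin 8 → ℝ) :
    HasDerivAt (fun t : ℝ => colForm (u + t • tangent x u))
      (2 * (x 3 + x 5) * colForm u
        - 2 * tangentPairing x fun i j => colVec u i * colVec u j) 0 := by
  have h := hasDerivAt_line u (tangent x u)
  have key := (((((h 0).fun_pow 2).const_sub 1).fun_sub ((h 2).fun_pow 2)).fun_mul
    ((h 4).fun_pow 2)).fun_sub
    (((((h 0).fun_mul (h 1)).fun_add ((h 2).fun_mul (h 3))).const_mul 2).fun_mul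
      ((h 4).fun_mul (h 5))) |>.fun_add
    (((((h 1).fun_pow 2).const_sub 1).fun_sub ((h 3).fun_pow 2)).fun_mul ((h 5).fun_pow 2))
  refine key.congr_deriv ?_
  simp [tangent, tangentPairing, colVec, colForm]
  ring

lemma hasDerivAt_rowForm (x : Fin 10 → ℝ) (u : Fin 8 → ℝ) :
    HasDerivAt (fun t : ℝ => rowForm (u + t • tangent x u))
      (2 * (x 0 + x 2) * rowForm u
        - 2 * tangentPairing x fun i j => rowVec u i * rowVec u j) 0 := by
  have h := hasDerivAt_line u (tangent x u)
  have key := (((((h 0).fun_pow 2).const_sub 1).fun_sub ((h 1).fun_pow 2)).fun_mul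
    ((h 6).fun_pow 2)).fun_sub
    (((((h 0).fun_mul (h 2)).fun_add ((h 1).fun_mul (h 3))).const_mul 2).fun_mul
      ((h 6).fun_mul (h 7))) |>.fun_add
    (((((h 2).fun_pow 2).const_sub 1).fun_sub ((h 3).fun_pow 2)).fun_mul ((h 7).fun_pow 2))
  refine key.congr_deriv ?_
  simp [tangent, tangentPairing, rowVec, rowForm]
  ring

lemma hasDerivAt_ballDet (x : Fin 10 → ℝ) (u : Fin 8 → ℝ) :
    HasDerivAt (fun t : ℝ => ballDet (u + t • tangent x u))
      (2 * (x 3 + x 5) * ballDet u - 2 * tangentPairing x (graphMatrix u)) 0 := by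
  have h := hasDerivAt_line u (tangent x u)
  have key := ((((((h 0).fun_pow 2).fun_add ((h 1).fun_pow 2)).fun_add ((h 2).fun_pow 2)).fun_add
    ((h 3).fun_pow 2)).const_sub 1).fun_add
    ((((h 0).fun_mul (h 3)).fun_sub ((h 1).fun_mul (h 2))).fun_pow 2)
  refine key.congr_deriv ?_
  simp [tangent, tangentPairing, graphMatrix, ballDet]
  ring

/-- The matrix `a₀ g₀ g₀ᵀ + a₁ g₁ g₁ᵀ - a₂ g₂ g₂ᵀ - a₃ g₃ g₃ᵀ - a₀ J`, where `g` is the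
pseudo-orthogonal frame attached to `(W, w, ψ)`. -/
noncomputable def momentMatrix (a : Fin 4 → ℝ) (u : Fin 8 → ℝ) (i j : Fin 4) : ℝ :=
  (a 0 - a 3) * (graphMatrix u i j / ballDet u)
    - (a 2 - a 3) * (colVec u i * colVec u j / colForm u)
    - (a 0 - a 1) * (rowVec u i * rowVec u j / rowForm u)

/-- The logarithm of `ballWeight`. -/
noncomputable def logWeight (a : Fin 4 → ℝ) (u : Fin 8 → ℝ) : ℝ :=
  -(a 2 - a 3) * Real.log (colForm u) + -(a 0 - a 1) * Real.log (rowForm u)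
    + (a 0 - a 3) * Real.log (ballDet u)

lemma ballWeight_eq_exp (a : Fin 4 → ℝ) {u : Fin 8 → ℝ} (hu : u ∈ ballDomain) :
    ballWeight a u = Real.exp (logWeight a u) := by
  rw [ballWeight, logWeight, Real.rpow_def_of_pos (colForm_pos hu),
    Real.rpow_def_of_pos (rowForm_pos hu), Real.rpow_def_of_pos hu.2.1, ← Real.exp_add,
    ← Real.exp_add]
  congr 1
  ring

lemma hasDerivAt_logWeight (a : Fin 4 → ℝ) (x : Fin 10 → ℝ) {u : Fin 8 → ℝ}
    (hu : u ∈ ballDomain) :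
    HasDerivAt (fun t : ℝ => logWeight a (u + t • tangent x u))
      (2 * ((x 3 + x 5) * (a 0 - a 2) - (x 0 + x 2) * (a 0 - a 1)
        - tangentPairing x (momentMatrix a u))) 0 := by
  have hn := colForm_pos hu
  have hq := rowForm_pos hu
  have hδ := hu.2.1
  have e : u + (0 : ℝ) • tangent x u = u := by simp
  have key := ((((hasDerivAt_colForm x u).log (by rw [e]; exact hn.ne')).const_mul
    (-(a 2 - a 3))).fun_add (((hasDerivAt_rowForm x u).log (by rw [e]; exact hq.ne')).const_mul
    (-(a 0 - a 1)))).fun_add (((hasDerivAt_ballDet x u).log (by rw [e]; exact hδ.ne')).const_mul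
    (a 0 - a 3))
  refine key.congr_deriv ?_
  rw [e]
  simp only [tangentPairing, momentMatrix]
  field_simp
  ring

lemma isOpen_ballDomain : IsOpen ballDomain := by
  have h : Continuous ballDet := by unfold ballDet; fun_prop
  refine IsOpen.and (isOpen_lt (by fun_prop) (by fun_prop)) (IsOpen.and (isOpen_lt (by fun_prop) h)
    (IsOpen.and (isOpen_lt (by fun_prop) (by fun_prop)) (isOpen_lt (by fun_prop) (by fun_prop))))

lemma stationary {e : Fin 16 → ℝ} {a b : Fin 4 → ℝ} {p : (Fin 8 → ℝ) × (Fin 8 → ℝ)}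
    (h₁ : p.1 ∈ ballDomain) (h₂ : p.2 ∈ ballDomain) (hpos : 0 < objective e a b p)
    (hmax : ∀ p' : (Fin 8 → ℝ) × (Fin 8 → ℝ), p'.1 ∈ ballDomain → p'.2 ∈ ballDomain →
      objective e a b p' ≤ objective e a b p)
    (x : Fin 10 → ℝ) (μ : Fin 16 → ℝ)
    (hμ : ∀ t : ℝ, ∀ k, semiInv (p.1 + t • tangent x p.1, p.2 + t • tangent x p.2) k
      = (1 + t * μ k) * semiInv p k) :
    tangentPairing x (momentMatrix a p.1) + tangentPairing x (momentMatrix b p.2)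
      = ∑ k, e k * μ k + (x 3 + x 5) * (a 0 - a 2 + (b 0 - b 2))
        - (x 0 + x 2) * (a 0 - a 1 + (b 0 - b 1)) := by
  set G : ℝ → ℝ := fun t => 2 * ∑ k, e k * Real.log (1 + t * μ k)
    + (logWeight a (p.1 + t • tangent x p.1) + logWeight b (p.2 + t • tangent x p.2)) with hG
  have hlog (k : Fin 16) : HasDerivAt (fun t : ℝ => e k * Real.log (1 + t * μ k)) (e k * μ k) 0 := by
    have := ((((hasDerivAt_id (0 : ℝ)).mul_const (μ k)).const_add 1).log (by simp)).const_mul (e k)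
    simpa using this
  have hderiv := ((HasDerivAt.fun_sum fun k (_ : k ∈ Finset.univ) => hlog k).const_mul 2).fun_add
    ((hasDerivAt_logWeight a x h₁).fun_add (hasDerivAt_logWeight b x h₂))
  have hS : 0 < semiInvProd e p ^ 2 := by
    refine (sq_nonneg _).lt_of_ne fun h => ?_
    rw [objective, ← h, zero_mul] at hpos
    exact lt_irrefl _ hpos
  have hloc : IsLocalMax G 0 := by
    have c₁ : ∀ᶠ t : ℝ in nhds 0, p.1 + t • tangent x p.1 ∈ ballDomain := by
      refine (Continuous.continuousAt (by fun_prop)).eventually_mem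
        (isOpen_ballDomain.mem_nhds ?_)
      simpa using h₁
    have c₂ : ∀ᶠ t : ℝ in nhds 0, p.2 + t • tangent x p.2 ∈ ballDomain := by
      refine (Continuous.continuousAt (by fun_prop)).eventually_mem
        (isOpen_ballDomain.mem_nhds ?_)
      simpa using h₂
    have c₃ : ∀ᶠ t : ℝ in nhds 0, ∀ k, 0 < 1 + t * μ k := by
      rw [Filter.eventually_all]
      intro k
      refine (Continuous.continuousAt (by fun_prop)).eventually_mem (Ioi_mem_nhds ?_)
      simp
    have hobj (t : ℝ) (k₁ : p.1 + t • tangent x p.1 ∈ ballDomain)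
        (k₂ : p.2 + t • tangent x p.2 ∈ ballDomain) (k₃ : ∀ k, 0 < 1 + t * μ k) :
        objective e a b (p.1 + t • tangent x p.1, p.2 + t • tangent x p.2)
          = semiInvProd e p ^ 2 * Real.exp (G t) := by
      rw [objective, semiInvProd_of_scale k₃ e (hμ t), ballWeight_eq_exp a k₁,
        ballWeight_eq_exp b k₂, hG]
      simp only [Real.exp_add, mul_pow, ← Real.exp_nat_mul, Nat.cast_ofNat]
      ring
    have hobj₀ := hobj 0 (by simpa using h₁) (by simpa using h₂) (by simp)
    filter_upwards [c₁, c₂, c₃] with t k₁ k₂ k₃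
    have := hmax (p.1 + t • tangent x p.1, p.2 + t • tangent x p.2) k₁ k₂
    rw [hobj t k₁ k₂ k₃] at this
    rw [show p = (p.1 + (0 : ℝ) • tangent x p.1, p.2 + (0 : ℝ) • tangent x p.2) by simp] at this
    rw [hobj₀] at this
    simp only [zero_smul, add_zero, Prod.mk.eta] at this
    exact Real.exp_le_exp.mp (le_of_mul_le_mul_left this hS)
  have hzero := hloc.hasDerivAt_eq_zero hderiv
  linarith

/-- The exponents `e` realise the spectrum `c`. -/
structure HasSpectrum (e : Fin 16 → ℝ) (a b c : Fin 4 → ℝ) : Prop where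
  zero : c 0 = a 1 + b 1 + (e 0 + e 1 + e 2 + (e 6 + e 7 + e 8 + e 9 + e 10 + e 11
    + e 12 + e 13 + e 14) + e 15)
  one : c 1 = a 1 + b 1 + (e 0 + (e 6 + e 7 + e 8 + e 9 + e 10 + e 11) + e 15)
  two : c 2 = a 2 + b 2 - (e 3 + (e 6 + e 7 + e 9 + e 10 + e 12 + e 13) + e 15)
  three : c 3 = a 2 + b 2 - (e 3 + e 4 + e 5 + (e 6 + e 7 + e 8 + e 9 + e 10 + e 11
    + e 12 + e 13 + e 14) + e 15)

lemma momentMatrix_symm (a : Fin 4 → ℝ) (u : Fin 8 → ℝ) (i j : Fin 4) :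
    momentMatrix a u i j = momentMatrix a u j i := by
  simp only [momentMatrix, graphMatrix]
  ring

lemma eq_diagonal_of_symm {F : Fin 4 → Fin 4 → ℝ} {d : Fin 4 → ℝ} (hs : ∀ i j, F i j = F j i)
    (hd : ∀ i, F i i = d i) (h₀ : F 0 1 = 0 ∧ F 0 2 = 0 ∧ F 0 3 = 0)
    (h₁ : F 1 2 = 0 ∧ F 1 3 = 0 ∧ F 2 3 = 0) (i j : Fin 4) : F i j = Matrix.diagonal d i j := by
  have h₁₀ := hs 1 0
  have h₂₀ := hs 2 0
  have h₃₀ := hs 3 0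
  have h₂₁ := hs 2 1
  have h₃₁ := hs 3 1
  have h₃₂ := hs 3 2
  clear hs
  fin_cases i <;> fin_cases j <;> simp_all [Matrix.diagonal]

set_option maxHeartbeats 800000 in
lemma moment_off_diagonal {e : Fin 16 → ℝ} {a b : Fin 4 → ℝ}
    {p : (Fin 8 → ℝ) × (Fin 8 → ℝ)}
    (h₁ : p.1 ∈ ballDomain) (h₂ : p.2 ∈ ballDomain) (hpos : 0 < objective e a b p)
    (hmax : ∀ p' : (Fin 8 → ℝ) × (Fin 8 → ℝ), p'.1 ∈ ballDomain → p'.2 ∈ ballDomain →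
      objective e a b p' ≤ objective e a b p) :
    let F := fun i j => momentMatrix a p.1 i j + momentMatrix b p.2 i j
    (F 0 1 = 0 ∧ F 0 2 = 0 ∧ F 0 3 = 0) ∧ (F 1 2 = 0 ∧ F 1 3 = 0 ∧ F 2 3 = 0) := by
  have st := stationary h₁ h₂ hpos hmax
  have m₁ := st (Pi.single 1 1) 0
    (by intro t k; fin_cases k <;> simp [semiInv, tangent] <;> ring)
  have m₄ := st (Pi.single 4 1) 0
    (by intro t k; fin_cases k <;> simp [semiInv, tangent] <;> ring)
  have m₆ := st (Pi.single 6 1) 0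
    (by intro t k; fin_cases k <;> simp [semiInv, tangent])
  have m₇ := st (Pi.single 7 1) 0
    (by intro t k; fin_cases k <;> simp [semiInv, tangent])
  have m₈ := st (Pi.single 8 1) 0
    (by intro t k; fin_cases k <;> simp [semiInv, tangent])
  have m₉ := st (Pi.single 9 1) 0
    (by intro t k; fin_cases k <;> simp [semiInv, tangent])
  simp only [tangentPairing] at m₁ m₄ m₆ m₇ m₈ m₉
  simp at m₁ m₄ m₆ m₇ m₈ m₉
  exact ⟨⟨m₁, m₆, m₇⟩, m₈, m₉, m₄⟩

lemma moment_diagonal {e : Fin 16 → ℝ} {a b c : Fin 4 → ℝ} (hc : HasSpectrum e a b c)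
    {p : (Fin 8 → ℝ) × (Fin 8 → ℝ)}
    (h₁ : p.1 ∈ ballDomain) (h₂ : p.2 ∈ ballDomain) (hpos : 0 < objective e a b p)
    (hmax : ∀ p' : (Fin 8 → ℝ) × (Fin 8 → ℝ), p'.1 ∈ ballDomain → p'.2 ∈ ballDomain →
      objective e a b p' ≤ objective e a b p) (i : Fin 4) :
    momentMatrix a p.1 i i + momentMatrix b p.2 i i =
      ![c 0 - a 0 - b 0, c 1 - a 0 - b 0, a 0 + b 0 - c 2, a 0 + b 0 - c 3] i := by
  have st := stationary h₁ h₂ hpos hmax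
  have m₀ := st (Pi.single 0 1) ![1, 1, 1, 0, 0, 0, 1, 1, 1, 1, 1, 1, 1, 1, 1, 1]
    (by intro t k; fin_cases k <;> simp [semiInv, tangent] <;> ring)
  have m₁ := st (Pi.single 2 1) ![1, 0, 0, 0, 0, 0, 1, 1, 1, 1, 1, 1, 0, 0, 0, 1]
    (by intro t k; fin_cases k <;> simp [semiInv, tangent] <;> ring)
  have m₂ := st (Pi.single 3 1) ![0, 0, 0, 1, 0, 0, 1, 1, 0, 1, 1, 0, 1, 1, 0, 1]
    (by intro t k; fin_cases k <;> simp [semiInv, tangent] <;> ring)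
  have m₃ := st (Pi.single 5 1) ![0, 0, 0, 1, 1, 1, 1, 1, 1, 1, 1, 1, 1, 1, 1, 1]
    (by intro t k; fin_cases k <;> simp [semiInv, tangent] <;> ring)
  rw [sum_fin_sixteen] at m₀ m₁ m₂ m₃
  have hc₀ := hc.zero
  have hc₁ := hc.one
  have hc₂ := hc.two
  have hc₃ := hc.three
  simp [tangentPairing] at m₀ m₁ m₂ m₃
  fin_cases i <;> simp
  · linarith only [m₀, hc₀]
  · linarith only [m₁, hc₁]
  · linarith only [m₂, hc₂]
  · linarith only [m₃, hc₃]

lemma moment_equations {e : Fin 16 → ℝ} {a b c : Fin 4 → ℝ} (hc : HasSpectrum e a b c)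
    {p : (Fin 8 → ℝ) × (Fin 8 → ℝ)}
    (h₁ : p.1 ∈ ballDomain) (h₂ : p.2 ∈ ballDomain) (hpos : 0 < objective e a b p)
    (hmax : ∀ p' : (Fin 8 → ℝ) × (Fin 8 → ℝ), p'.1 ∈ ballDomain → p'.2 ∈ ballDomain →
      objective e a b p' ≤ objective e a b p) (i j : Fin 4) :
    momentMatrix a p.1 i j + momentMatrix b p.2 i j =
      Matrix.diagonal ![c 0 - a 0 - b 0, c 1 - a 0 - b 0, a 0 + b 0 - c 2, a 0 + b 0 - c 3]
        i j := by
  have h := moment_off_diagonal h₁ h₂ hpos hmax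
  exact eq_diagonal_of_symm (F := fun i j => momentMatrix a p.1 i j + momentMatrix b p.2 i j)
    (fun i j => by rw [momentMatrix_symm a, momentMatrix_symm b])
    (moment_diagonal hc h₁ h₂ hpos hmax) h.1 h.2 i j

/-- The vector `(W z, z)` orthogonal to `colVec` for the signed form. -/
def colPerp (u : Fin 8 → ℝ) : Fin 4 → ℝ :=
  let r := (u 0 * u 1 + u 2 * u 3) * u 4 - (1 - u 1 ^ 2 - u 3 ^ 2) * u 5
  let s := (1 - u 0 ^ 2 - u 2 ^ 2) * u 4 - (u 0 * u 1 + u 2 * u 3) * u 5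
  ![u 0 * r + u 1 * s, u 2 * r + u 3 * s, r, s]

/-- The vector `(z, Wᵀ z)` orthogonal to `rowVec` for the signed form. -/
def rowPerp (u : Fin 8 → ℝ) : Fin 4 → ℝ :=
  let r := (u 0 * u 2 + u 1 * u 3) * u 6 - (1 - u 2 ^ 2 - u 3 ^ 2) * u 7
  let s := (1 - u 0 ^ 2 - u 1 ^ 2) * u 6 - (u 0 * u 2 + u 1 * u 3) * u 7
  ![r, s, u 0 * r + u 2 * s, u 1 * r + u 3 * s]

lemma colPerp_mul_colPerp (u : Fin 8 → ℝ) (i j : Fin 4) :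
    colPerp u i * colPerp u j =
      colForm u * graphMatrix u i j - ballDet u * (colVec u i * colVec u j) := by
  fin_cases i <;> fin_cases j <;>
    simp [colPerp, colForm, graphMatrix, ballDet, colVec] <;> ring

lemma rowPerp_mul_rowPerp (u : Fin 8 → ℝ) (i j : Fin 4) :
    rowPerp u i * rowPerp u j =
      rowForm u * (ballDet u * (Matrix.diagonal ![1, 1, -1, -1] : Matrix (Fin 4) (Fin 4) ℝ) i j
        + graphMatrix u i j) - ballDet u * (rowVec u i * rowVec u j) := by
  fin_cases i <;> fin_cases j <;>
    simp [rowPerp, rowForm, graphMatrix, ballDet, rowVec] <;> ring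

/-- The pseudo-orthonormal frame attached to a triple `(W, w, ψ)`. -/
noncomputable def ballFrame (u : Fin 8 → ℝ) : Matrix (Fin 4) (Fin 4) ℝ :=
  Matrix.of fun i => ![rowPerp u i / √(ballDet u * rowForm u), rowVec u i / √(rowForm u),
    colVec u i / √(colForm u), colPerp u i / √(ballDet u * colForm u)]

lemma ballFrame_mul_diagonal_mul (a : Fin 4 → ℝ) {u : Fin 8 → ℝ} (hu : u ∈ ballDomain) :
    ballFrame u * Matrix.diagonal ![a 0, a 1, -a 2, -a 3] * (ballFrame u)ᵀ =
      a 0 • Matrix.diagonal ![1, 1, -1, -1] + Matrix.of (momentMatrix a u) := by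
  have hn := colForm_pos hu
  have hq := rowForm_pos hu
  have hδ := hu.2.1
  have key (x y s t : ℝ) (hs : 0 < s) : x / √s * t * (y / √s) = t * (x * y / s) := by
    rw [show x / √s * t * (y / √s) = t * (x * y / (√s * √s)) by ring, Real.mul_self_sqrt hs.le]
  ext i j
  rw [Matrix.mul_apply]
  simp only [Matrix.mul_diagonal, Matrix.transpose_apply, Fin.sum_univ_four, ballFrame,
    Matrix.of_apply, Matrix.cons_val, key _ _ _ _ hn, key _ _ _ _ hq, key _ _ _ _ (mul_pos hδ hn),
    key _ _ _ _ (mul_pos hδ hq), colPerp_mul_colPerp, rowPerp_mul_rowPerp, Matrix.add_apply,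
    Matrix.smul_apply, smul_eq_mul, momentMatrix]
  field_simp
  ring

lemma signedDiag_two_two (a : Fin 4 → ℝ) :
    signedDiag 2 2 a =
      (Matrix.diagonal ![a 0, a 1, -a 2, -a 3]).map (algebraMap ℝ ℂ) := by
  rw [signedDiag, Ipq, Matrix.diagonal_mul_diagonal, Matrix.diagonal_map (map_zero _)]
  congr 1
  ext i
  fin_cases i <;> simp

lemma map_mul_signedDiag_mul (a : Fin 4 → ℝ) (g : Matrix (Fin 4) (Fin 4) ℝ) :
    g.map (algebraMap ℝ ℂ) * signedDiag 2 2 a * (g.map (algebraMap ℝ ℂ))ᴴ =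
      (g * Matrix.diagonal ![a 0, a 1, -a 2, -a 3] * gᵀ).map (algebraMap ℝ ℂ) := by
  have hg : (g.map (algebraMap ℝ ℂ))ᴴ = gᵀ.map (algebraMap ℝ ℂ) := by
    ext i j
    simp
  rw [hg, signedDiag_two_two, ← Matrix.map_mul, ← Matrix.map_mul]

lemma ballFrame_mem_Upq {u : Fin 8 → ℝ} (hu : u ∈ ballDomain) :
    (ballFrame u).map (algebraMap ℝ ℂ) ∈ Upq 2 2 := by
  have h : (ballFrame u).map (algebraMap ℝ ℂ) * Ipq 2 2 * ((ballFrame u).map (algebraMap ℝ ℂ))ᴴ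
      = Ipq 2 2 := by
    have hm : Matrix.of (momentMatrix 1 u) = 0 := by
      ext i j
      simp [momentMatrix]
    rw [← signedDiag_one, map_mul_signedDiag_mul, ballFrame_mul_diagonal_mul 1 hu, hm,
      signedDiag_two_two]
    simp
  refine ⟨IsUnit.of_mul_eq_one (Ipq 2 2 * ((ballFrame u).map (algebraMap ℝ ℂ))ᴴ * Ipq 2 2) ?_, h⟩
  rw [← Matrix.mul_assoc, ← Matrix.mul_assoc]
  exact (congrArg (· * Ipq 2 2) h).trans (Ipq_mul_self 2 2)

lemma orbit_subset_of_real {a b c : Fin 4 → ℝ} {g h : Matrix (Fin 4) (Fin 4) ℝ}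
    (hg : g.map (algebraMap ℝ ℂ) ∈ Upq 2 2) (hh : h.map (algebraMap ℝ ℂ) ∈ Upq 2 2)
    (hgh : Matrix.diagonal ![c 0, c 1, -c 2, -c 3] =
      g * Matrix.diagonal ![a 0, a 1, -a 2, -a 3] * gᵀ
        + h * Matrix.diagonal ![b 0, b 1, -b 2, -b 3] * hᵀ) :
    Orbit 2 2 c ⊆ Orbit 2 2 a + Orbit 2 2 b := by
  have key : signedDiag 2 2 c =
      g.map (algebraMap ℝ ℂ) * signedDiag 2 2 a * (g.map (algebraMap ℝ ℂ))ᴴ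
        + h.map (algebraMap ℝ ℂ) * signedDiag 2 2 b * (h.map (algebraMap ℝ ℂ))ᴴ := by
    rw [map_mul_signedDiag_mul a g, map_mul_signedDiag_mul b h, signedDiag_two_two, hgh]
    exact Matrix.map_add _ (map_add _) _ _
  exact (orbit_subset_add_iff (p := 2) (q := 2) a b c).mpr
    ⟨g.map (algebraMap ℝ ℂ), hg, h.map (algebraMap ℝ ℂ), hh, key⟩

lemma orbit_subset_of_exponents {e : Fin 16 → ℝ} (he : ∀ k, 0 ≤ e k) {a b c : Fin 4 → ℝ}
    (ha : a 1 ≤ a 0) (ha' : a 2 < a 1) (ha'' : a 3 ≤ a 2)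
    (hb : b 1 ≤ b 0) (hb' : b 2 < b 1) (hb'' : b 3 ≤ b 2)
    (hab : IsHomogeneous e a b) (hc : HasSpectrum e a b c) :
    Orbit 2 2 c ⊆ Orbit 2 2 a + Orbit 2 2 b := by
  obtain ⟨p, h₁, h₂, hpos, hmax⟩ := exists_maximizer he hab ha ha' ha'' hb hb' hb''
  refine orbit_subset_of_real (ballFrame_mem_Upq h₁) (ballFrame_mem_Upq h₂) ?_
  have hm : Matrix.of (momentMatrix a p.1) + Matrix.of (momentMatrix b p.2) =
      Matrix.diagonal ![c 0 - a 0 - b 0, c 1 - a 0 - b 0, a 0 + b 0 - c 2, a 0 + b 0 - c 3] := by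
    ext i j
    exact moment_equations hc h₁ h₂ hpos hmax i j
  rw [ballFrame_mul_diagonal_mul a h₁, ballFrame_mul_diagonal_mul b h₂, add_add_add_comm, hm,
    ← add_smul, ← Matrix.diagonal_smul, Matrix.diagonal_add]
  congr 1
  ext i
  fin_cases i <;> simp <;> ring

lemma exists_quadrilateral {x₁ x₂ x₃ x₄ : ℝ} (h₁ : x₁ ≤ x₂ + x₃ + x₄) (h₂ : x₂ ≤ x₁ + x₃ + x₄)
    (h₃ : x₃ ≤ x₁ + x₂ + x₄) (h₄ : x₄ ≤ x₁ + x₂ + x₃) (p₁ : 0 ≤ x₁) (p₂ : 0 ≤ x₂) (p₃ : 0 ≤ x₃)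
    (p₄ : 0 ≤ x₄) :
    ∃ m₁₂ m₁₃ m₂₃ m₁₄ m₂₄ m₃₄ : ℝ, (0 ≤ m₁₂ ∧ 0 ≤ m₁₃ ∧ 0 ≤ m₂₃ ∧ 0 ≤ m₁₄ ∧ 0 ≤ m₂₄ ∧ 0 ≤ m₃₄) ∧
      x₁ = m₁₂ + m₁₃ + m₁₄ ∧ x₂ = m₁₂ + m₂₃ + m₂₄ ∧ x₃ = m₁₃ + m₂₃ + m₃₄ ∧
      x₄ = m₁₄ + m₂₄ + m₃₄ := by
  have hB := le_max_left 0 ((x₂ + x₄ - x₁ - x₃) / 2)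
  have hB' := le_max_right 0 ((x₂ + x₄ - x₁ - x₃) / 2)
  have hC := le_max_left 0 ((x₂ + x₃ - x₁ - x₄) / 2)
  have hC' := le_max_right 0 ((x₂ + x₃ - x₁ - x₄) / 2)
  have hBC : max 0 ((x₂ + x₄ - x₁ - x₃) / 2) + max 0 ((x₂ + x₃ - x₁ - x₄) / 2) ≤
      min ((x₂ + x₃ + x₄ - x₁) / 2) x₂ := by
    rcases max_cases 0 ((x₂ + x₄ - x₁ - x₃) / 2) with ⟨h, -⟩ | ⟨h, -⟩ <;>
    rcases max_cases 0 ((x₂ + x₃ - x₁ - x₄) / 2) with ⟨h', -⟩ | ⟨h', -⟩ <;>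
    rw [h, h'] <;> refine le_min ?_ ?_ <;> linarith
  generalize max 0 ((x₂ + x₄ - x₁ - x₃) / 2) = s at *
  generalize max 0 ((x₂ + x₃ - x₁ - x₄) / 2) = t at *
  have := hBC.trans (min_le_left _ _)
  have := hBC.trans (min_le_right _ _)
  refine ⟨x₂ - s - t, s + (x₁ + x₃ - x₂ - x₄) / 2, t, t + (x₁ + x₄ - x₂ - x₃) / 2, s,
    (x₂ + x₃ + x₄ - x₁) / 2 - s - t, ⟨?_, ?_, ?_, ?_, ?_, ?_⟩, ?_, ?_, ?_, ?_⟩ <;> linarith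

/-- A nonnegative `3 × 3` matrix with prescribed nonnegative margins of equal sum. -/
lemma exists_margins {l r : Fin 3 → ℝ} {σ : ℝ} (hl : ∀ i, 0 ≤ l i) (hr : ∀ i, 0 ≤ r i)
    (hlσ : ∑ i, l i = σ) (hrσ : ∑ i, r i = σ) :
    ∃ m : Fin 3 → Fin 3 → ℝ, (∀ i j, 0 ≤ m i j) ∧ (∀ i, ∑ j, m i j = l i) ∧
      ∀ j, ∑ i, m i j = r j := by
  have hσ : 0 ≤ σ := hlσ ▸ Finset.sum_nonneg fun i _ => hl i
  refine ⟨fun i j => l i * r j / σ, fun i j => div_nonneg (mul_nonneg (hl i) (hr j)) hσ,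
    fun i => ?_, fun j => ?_⟩
  · rw [← Finset.sum_div, ← Finset.mul_sum, hrσ]
    refine mul_div_cancel_of_imp fun h => ?_
    exact (Finset.sum_eq_zero_iff_of_nonneg fun i _ => hl i).mp (hlσ.trans h) i (Finset.mem_univ i)
  · rw [← Finset.sum_div, ← Finset.sum_mul, hlσ, mul_comm]
    refine mul_div_cancel_of_imp fun h => ?_
    exact (Finset.sum_eq_zero_iff_of_nonneg fun i _ => hr i).mp (hrσ.trans h) j (Finset.mem_univ j)

lemma exists_exponents {a b c : Fin 4 → ℝ} {σ : ℝ} (hσ : 0 ≤ σ)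
    (ha : a 1 ≤ a 0) (ha' : a 3 ≤ a 2) (hb : b 1 ≤ b 0) (hb' : b 3 ≤ b 2)
    (hc : c 1 ≤ c 0) (hc' : c 3 ≤ c 2)
    (hsum : a 0 + a 1 + a 2 + a 3 + b 0 + b 1 + b 2 + b 3 = c 0 + c 1 + c 2 + c 3)
    (hT : σ ≤ c 0 + c 1 - a 0 - a 1 - b 0 - b 1)
    (l₀ : a 0 - a 1 ≤ b 0 - b 1 + (c 0 - c 1) + σ) (l₁ : b 0 - b 1 ≤ a 0 - a 1 + (c 0 - c 1) + σ)
    (l₂ : c 0 - c 1 ≤ a 0 - a 1 + (b 0 - b 1) + σ) (l₃ : σ ≤ a 0 - a 1 + (b 0 - b 1) + (c 0 - c 1))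
    (r₀ : a 2 - a 3 ≤ b 2 - b 3 + (c 2 - c 3) + σ) (r₁ : b 2 - b 3 ≤ a 2 - a 3 + (c 2 - c 3) + σ)
    (r₂ : c 2 - c 3 ≤ a 2 - a 3 + (b 2 - b 3) + σ)
    (r₃ : σ ≤ a 2 - a 3 + (b 2 - b 3) + (c 2 - c 3)) :
    ∃ e : Fin 16 → ℝ, (∀ k, 0 ≤ e k) ∧ IsHomogeneous e a b ∧ HasSpectrum e a b c := by
  obtain ⟨l₁₂, l₁₃, l₂₃, l₁₄, l₂₄, l₃₄, ⟨p₁, p₂, p₃, p₄, p₅, p₆⟩, hl₁, hl₂, hl₃, hl₄⟩ :=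
    exists_quadrilateral l₀ l₁ l₂ l₃ (sub_nonneg.mpr ha) (sub_nonneg.mpr hb) (sub_nonneg.mpr hc) hσ
  obtain ⟨r₁₂, r₁₃, r₂₃, r₁₄, r₂₄, r₃₄, ⟨q₁, q₂, q₃, q₄, q₅, q₆⟩, hr₁, hr₂, hr₃, hr₄⟩ :=
    exists_quadrilateral r₀ r₁ r₂ r₃ (sub_nonneg.mpr ha') (sub_nonneg.mpr hb')
      (sub_nonneg.mpr hc') hσ
  obtain ⟨m, hm, hml, hmr⟩ := exists_margins (l := ![l₁₄, l₂₄, l₃₄]) (r := ![r₁₄, r₂₄, r₃₄]) (σ := σ)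
    (by simp [Fin.forall_fin_succ, p₄, p₅, p₆]) (by simp [Fin.forall_fin_succ, q₄, q₅, q₆])
    (by simp [Fin.sum_univ_three, hl₄]) (by simp [Fin.sum_univ_three, hr₄])
  have w₀ := hml 0
  have w₁ := hml 1
  have w₂ := hml 2
  have v₀ := hmr 0
  have v₁ := hmr 1
  have v₂ := hmr 2
  simp only [Fin.sum_univ_three, Matrix.cons_val] at w₀ w₁ w₂ v₀ v₁ v₂
  refine ⟨![l₁₂, l₁₃, l₂₃, r₁₂, r₁₃, r₂₃, m 0 0, m 0 1, m 0 2, m 1 0, m 1 1, m 1 2, m 2 0, m 2 1,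
    m 2 2, (c 0 + c 1 - a 0 - a 1 - b 0 - b 1 - σ) / 2], ?_, ⟨?_, ?_, ?_, ?_⟩, ⟨?_, ?_, ?_, ?_⟩⟩
  · intro k
    fin_cases k <;> simp [p₁, p₂, p₃, q₁, q₂, q₃, hm, -sub_nonneg]
    linarith
  all_goals simp only [Matrix.cons_val]; linarith

lemma exists_between_three {l₁ l₂ l₃ l₄ l₅ l₆ l₇ u₁ u₂ u₃ : ℝ}
    (h₁ : ∀ l ∈ [l₁, l₂, l₃, l₄, l₅, l₆, l₇], l ≤ u₁)
    (h₂ : ∀ l ∈ [l₁, l₂, l₃, l₄, l₅, l₆, l₇], l ≤ u₂)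
    (h₃ : ∀ l ∈ [l₁, l₂, l₃, l₄, l₅, l₆, l₇], l ≤ u₃) :
    ∃ σ, (l₁ ≤ σ ∧ l₂ ≤ σ ∧ l₃ ≤ σ ∧ l₄ ≤ σ ∧ l₅ ≤ σ ∧ l₆ ≤ σ ∧ l₇ ≤ σ) ∧
      σ ≤ u₁ ∧ σ ≤ u₂ ∧ σ ≤ u₃ := by
  have hmin : ∀ l ∈ [l₁, l₂, l₃, l₄, l₅, l₆, l₇], l ≤ min u₁ (min u₂ u₃) := fun l hl =>
    le_min (h₁ l hl) (le_min (h₂ l hl) (h₃ l hl))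
  simp only [List.forall_mem_cons] at hmin
  exact ⟨min u₁ (min u₂ u₃), by tauto, by simp⟩
theorem statement11 (a b c : Fin (2 + 2) → ℝ) :
    (a ∈ Chol 2 2 ∧ b ∈ Chol 2 2 ∧ c ∈ Chol 2 2 ∧
        Orbit 2 2 c ⊆ Orbit 2 2 a + Orbit 2 2 b) ↔
    ((a 0 ≥ a 1 ∧ a 1 > a 2 ∧ a 2 ≥ a 3) ∧
     (b 0 ≥ b 1 ∧ b 1 > b 2 ∧ b 2 ≥ b 3) ∧
     (c 0 ≥ c 1 ∧ c 1 > c 2 ∧ c 2 ≥ c 3) ∧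
     a 0 + a 1 + a 2 + a 3 + b 0 + b 1 + b 2 + b 3 = c 0 + c 1 + c 2 + c 3 ∧
     a 0 + a 1 + b 0 + b 1 ≤ c 0 + c 1 ∧
     a 1 + b 1 ≤ c 1 ∧
     a 1 + b 0 ≤ c 0 ∧
     a 0 + b 1 ≤ c 0 ∧
     a 2 + b 2 ≥ c 2 ∧
     a 2 + b 3 ≥ c 3 ∧
     a 3 + b 2 ≥ c 3 ∧
     a 1 + a 3 + b 1 + b 3 ≤ c 0 + c 3 ∧
     a 1 + a 3 + b 1 + b 3 ≤ c 1 + c 2 ∧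
     a 1 + a 3 + b 0 + b 3 ≤ c 0 + c 2 ∧
     a 0 + a 3 + b 1 + b 3 ≤ c 0 + c 2 ∧
     a 1 + a 3 + b 1 + b 2 ≤ c 0 + c 2 ∧
     a 1 + a 2 + b 1 + b 3 ≤ c 0 + c 2) := by
  rw [mem_Chol_two_two, mem_Chol_two_two, mem_Chol_two_two]
  constructor
  · rintro ⟨ha, hb, hc, hsub⟩
    obtain ⟨P, Q, h⟩ := exists_isFormSum hsub
    have hsum := sum_eq_of_orbit_subset hsub
    rw [Fin.sum_univ_four, Fin.sum_univ_four, Fin.sum_univ_four] at hsum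
    have e₁ := h.add_le_add ha.1 ha.2.1 ha.2.2 hb.1 hb.2.1 hb.2.2
    obtain ⟨e₂, e₃, e₄, e₅⟩ :=
      h.extremal_inequalities ha.1 ha.2.1 ha.2.2 hb.1 hb.2.1 hb.2.2 hc.1 hc.2.2
    obtain ⟨-, -, e₆, e₇⟩ :=
      h.symm.extremal_inequalities hb.1 hb.2.1 hb.2.2 ha.1 ha.2.1 ha.2.2 hc.1 hc.2.2
    obtain ⟨f₁, f₂, f₃, f₄⟩ :=
      h.mixed_inequalities ha.1 ha.2.1 ha.2.2 hb.1 hb.2.1 hb.2.2 hc.1 hc.2.1 hc.2.2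
    obtain ⟨-, -, f₅, f₆⟩ :=
      h.symm.mixed_inequalities hb.1 hb.2.1 hb.2.2 ha.1 ha.2.1 ha.2.2 hc.1 hc.2.1 hc.2.2
    refine ⟨ha, hb, hc, ?_, ?_, ?_, ?_, ?_, ?_, ?_, ?_, ?_, ?_, ?_, ?_, ?_, ?_⟩ <;> linarith
  · rintro ⟨ha, hb, hc, hsum, e₁, e₂, e₃, e₄, e₅, e₆, e₇, f₁, f₂, f₃, f₄, f₅, f₆⟩
    refine ⟨ha, hb, hc, ?_⟩
    obtain ⟨ha₀, ha₁, ha₂⟩ := ha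
    obtain ⟨hb₀, hb₁, hb₂⟩ := hb
    obtain ⟨hc₀, hc₁, hc₂⟩ := hc
    obtain ⟨σ, ⟨k₁, k₂, k₃, k₄, k₅, k₆, k₇⟩, hT, hl, hr⟩ :=
      exists_between_three (l₁ := 0) (l₂ := a 0 - a 1 - (b 0 - b 1) - (c 0 - c 1))
        (l₃ := b 0 - b 1 - (a 0 - a 1) - (c 0 - c 1)) (l₄ := c 0 - c 1 - (a 0 - a 1) - (b 0 - b 1))
        (l₅ := a 2 - a 3 - (b 2 - b 3) - (c 2 - c 3)) (l₆ := b 2 - b 3 - (a 2 - a 3) - (c 2 - c 3))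
        (l₇ := c 2 - c 3 - (a 2 - a 3) - (b 2 - b 3)) (u₁ := c 0 + c 1 - a 0 - a 1 - b 0 - b 1)
        (u₂ := a 0 - a 1 + (b 0 - b 1) + (c 0 - c 1)) (u₃ := a 2 - a 3 + (b 2 - b 3) + (c 2 - c 3))
        (by
          simp only [List.forall_mem_cons, List.not_mem_nil, false_imp_iff, implies_true, and_true]
          refine ⟨?_, ?_, ?_, ?_, ?_, ?_, ?_⟩ <;> linarith)
        (by
          simp only [List.forall_mem_cons, List.not_mem_nil, false_imp_iff, implies_true, and_true]
          refine ⟨?_, ?_, ?_, ?_, ?_, ?_, ?_⟩ <;> linarith)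
        (by
          simp only [List.forall_mem_cons, List.not_mem_nil, false_imp_iff, implies_true, and_true]
          refine ⟨?_, ?_, ?_, ?_, ?_, ?_, ?_⟩ <;> linarith)
    obtain ⟨e, he, hhom, hspec⟩ := exists_exponents k₁ ha₀ ha₂ hb₀ hb₂ hc₀ hc₂ hsum hT
      (by linarith) (by linarith) (by linarith) hl (by linarith) (by linarith) (by linarith) hr
    exact orbit_subset_of_exponents he ha₀ ha₁ ha₂ hb₀ hb₁ hb₂ hhom hspec
end

section
/- The set of strongly elliptic elements {X ∈ 𝔲(p,q) : the stabilizer {g ∈ U(p,q) : g · X = X · g} is a compact subset of M_n(ℂ)} is a nonempty open subset of 𝔲(p,q). -/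
open Matrix Complex Pointwise

/-- The Lie algebra `𝔲(p,q)`. -/
def upqLie (p q : ℕ) : Set (Matrix (Fin (p + q)) (Fin (p + q)) ℂ) :=
  {X | X * Ipq p q + Ipq p q * X.conjTranspose = 0}

/-- The invariant cone `C(p,q) ⊆ 𝔲(p,q)`. -/
def Cpq (p q : ℕ) : Set (Matrix (Fin (p + q)) (Fin (p + q)) ℂ) :=
  {X | X ∈ upqLie p q ∧ ∀ g ∈ Upq p q, 0 ≤ ((g * X * g⁻¹ * Ipq p q).trace).im}

/-- The interior of `C(p,q)` relative to the subspace `𝔲(p,q)`. -/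
def interiorC (p q : ℕ) : Set (Matrix (Fin (p + q)) (Fin (p + q)) ℂ) :=
  {X | ∃ h : X ∈ upqLie p q,
    (⟨X, h⟩ : upqLie p q) ∈ interior (Subtype.val ⁻¹' Cpq p q)}

section PseudoUnitary

variable {n : Type*} [Fintype n]

/-- The centralizer of `X` in the group of matrices preserving the form `J`. -/
def formCentralizer (J X : Matrix n n ℂ) : Set (Matrix n n ℂ) :=
  {g | g * J * gᴴ = J ∧ g * X = X * g}

/-- Some nonzero matrix commuting with `X` has totally `J`-isotropic range. -/
def HasIsotropicCommutant (J X : Matrix n n ℂ) : Prop :=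
  ∃ A : Matrix n n ℂ, A ≠ 0 ∧ A * X = X * A ∧ Aᴴ * J * A = 0

lemma isClosed_formCentralizer (J X : Matrix n n ℂ) : IsClosed (formCentralizer J X) :=
  (isClosed_eq (by fun_prop) (by fun_prop)).inter (isClosed_eq (by fun_prop) (by fun_prop))

variable [DecidableEq n]

open scoped Matrix.Norms.Operator in
lemma exp_mulVec_of_mulVec_eq_smul {X : Matrix n n ℂ} {v : n → ℂ} {c : ℂ}
    (h : X *ᵥ v = c • v) : NormedSpace.exp X *ᵥ v = Complex.exp c • v := by
  have hpow (k : ℕ) : X ^ k *ᵥ v = c ^ k • v := by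
    induction k with
    | zero => simp
    | succ k ih => rw [pow_succ, ← mulVec_mulVec, h, mulVec_smul, ih, smul_smul, pow_succ']
  have h1 : HasSum (fun k : ℕ => ((k.factorial : ℂ)⁻¹ • X ^ k) *ᵥ v)
      (NormedSpace.exp X *ᵥ v) := by
    exact (NormedSpace.exp_series_hasSum_exp' (𝕂 := ℂ) X).map (Matrix.mulVecBilin ℂ ℂ |>.flip v)
      (by
        change Continuous fun M : Matrix n n ℂ => M *ᵥ v
        fun_prop)
  have h2 : HasSum (fun k : ℕ => ((k.factorial : ℂ)⁻¹ • c ^ k) • v) (Complex.exp c • v) := by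
    rw [Complex.exp_eq_exp_ℂ]
    exact (NormedSpace.exp_series_hasSum_exp' (𝕂 := ℂ) c).smul_const v
  refine h1.unique (h2.congr_fun ?_)
  intro k
  rw [smul_mulVec, hpow, smul_assoc]

lemma exp_mem_formCentralizer {J X : Matrix n n ℂ} (hJ : J * J = 1) (hX : X * J + J * Xᴴ = 0)
    (t : ℝ) : NormedSpace.exp ((t : ℂ) • X) ∈ formCentralizer J X := by
  have hXJ : J * Xᴴ * J = -X := by
    rw [eq_neg_of_add_eq_zero_right hX, neg_mul, mul_assoc, hJ, mul_one]
  have hinv : J⁻¹ = J := inv_eq_right_inv hJ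
  have hunit : IsUnit (NormedSpace.exp ((t : ℂ) • X)) := Matrix.isUnit_exp _
  have hdet := (Matrix.isUnit_iff_isUnit_det _).mp hunit
  have hconj : J * (NormedSpace.exp ((t : ℂ) • X))ᴴ * J = (NormedSpace.exp ((t : ℂ) • X))⁻¹ := by
    have h := exp_conj J ((t : ℂ) • X)ᴴ (IsUnit.of_mul_eq_one J hJ)
    rw [hinv, exp_conjTranspose] at h
    rw [← h, ← Matrix.exp_neg]
    simp [hXJ]
  refine ⟨?_, ?_⟩
  · calc NormedSpace.exp ((t : ℂ) • X) * J * (NormedSpace.exp ((t : ℂ) • X))ᴴ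
        = NormedSpace.exp ((t : ℂ) • X) * (J * (NormedSpace.exp ((t : ℂ) • X))ᴴ * J) * J := by
          simp only [mul_assoc, hJ, mul_one]
      _ = J := by
          rw [hconj, mul_nonsing_inv _ hdet, one_mul]
  · open scoped Matrix.Norms.Operator in
    exact (((Commute.refl X).smul_left (t : ℂ)).exp_left).eq

attribute [local instance] Matrix.normedAddCommGroup Matrix.normedSpace

lemma conjTranspose_mul_mul_of_mul_mul_conjTranspose {J g : Matrix n n ℂ} (hJ : J * J = 1)
    (hg : g * J * gᴴ = J) : gᴴ * J * g = J := by
  have h1 : (g * J) * (gᴴ * J) = 1 := by rw [← mul_assoc, hg, hJ]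
  have h2 := mul_eq_one_comm.mp h1
  calc gᴴ * J * g = (gᴴ * J) * (g * J) * J := by simp only [mul_assoc, hJ, mul_one]
    _ = J := by rw [h2, one_mul]

lemma hasIsotropicCommutant_iff_exists_mem_sphere {J X : Matrix n n ℂ} :
    HasIsotropicCommutant J X ↔
      ∃ A ∈ Metric.sphere (0 : Matrix n n ℂ) 1, A * X = X * A ∧ Aᴴ * J * A = 0 := by
  constructor
  · rintro ⟨A, hA, hX, hJ⟩
    refine ⟨((‖A‖⁻¹ : ℝ) : ℂ) • A, ?_, ?_, ?_⟩
    · simp [norm_smul, hA]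
    · simp [hX]
    · simp [hJ]
  · rintro ⟨A, hA, h⟩
    refine ⟨A, ?_, h⟩
    rintro rfl
    simp at hA

/-- If no isotropic commutant exists, `‖Aᴴ J A‖` is bounded below on the unit sphere of the
commutant of `X`, which bounds the centralizer. -/
lemma isCompact_formCentralizer {J X : Matrix n n ℂ} (hJ : J * J = 1)
    (h : ¬ HasIsotropicCommutant J X) : IsCompact (formCentralizer J X) := by
  have hS : IsCompact (Metric.sphere (0 : Matrix n n ℂ) 1 ∩ {A | A * X = X * A}) :=
    (isCompact_sphere _ _).inter_right (isClosed_eq (by fun_prop) (by fun_prop))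
  obtain ⟨m, hm, hmS⟩ : ∃ m > 0, ∀ A ∈ Metric.sphere (0 : Matrix n n ℂ) 1 ∩ {A | A * X = X * A},
      m ≤ ‖Aᴴ * J * A‖ := by
    refine hS.exists_forall_le' (f := fun A => ‖Aᴴ * J * A‖) (a := 0) (by fun_prop) ?_
    rintro A ⟨hA, hAX⟩
    refine norm_pos_iff.mpr fun h0 => h ?_
    exact hasIsotropicCommutant_iff_exists_mem_sphere.mpr ⟨A, hA, hAX, h0⟩
  refine Metric.isCompact_of_isClosed_isBounded (isClosed_formCentralizer J X) ?_
  refine isBounded_iff_forall_norm_le.mpr ⟨√(‖J‖ / m), fun g hg => ?_⟩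
  by_cases hg0 : g = 0
  · simpa only [hg0, norm_zero] using Real.sqrt_nonneg _
  have hpos : 0 < ‖g‖ := norm_pos_iff.mpr hg0
  have hle := hmS (((‖g‖⁻¹ : ℝ) : ℂ) • g) ⟨by simp [norm_smul, hg0], by simp [hg.2]⟩
  have hJg := conjTranspose_mul_mul_of_mul_mul_conjTranspose hJ hg.1
  have hnorm : ‖(((‖g‖⁻¹ : ℝ) : ℂ) • g)ᴴ * J * (((‖g‖⁻¹ : ℝ) : ℂ) • g)‖
      = ‖g‖⁻¹ * (‖g‖⁻¹ * ‖J‖) := by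
    simp [norm_smul, hJg]
  rw [hnorm] at hle
  refine Real.le_sqrt_of_sq_le ((le_div_iff₀ hm).mpr ?_)
  calc ‖g‖ ^ 2 * m ≤ ‖g‖ ^ 2 * (‖g‖⁻¹ * (‖g‖⁻¹ * ‖J‖)) := by gcongr
    _ = ‖J‖ := by field_simp

lemma isClosed_setOf_hasIsotropicCommutant (J : Matrix n n ℂ) :
    IsClosed {X | HasIsotropicCommutant J X} := by
  have : CompactSpace (Metric.sphere (0 : Matrix n n ℂ) 1) :=
    isCompact_iff_compactSpace.mp (isCompact_sphere _ _)
  have hc : IsClosed {z : Metric.sphere (0 : Matrix n n ℂ) 1 × Matrix n n ℂ |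
      z.1.1 * z.2 = z.2 * z.1.1 ∧ z.1.1ᴴ * J * z.1.1 = 0} :=
    (isClosed_eq (by fun_prop) (by fun_prop)).inter (isClosed_eq (by fun_prop) (by fun_prop))
  convert isClosedMap_snd_of_compactSpace _ hc using 1
  ext X
  simp only [Set.mem_ofPred_eq, hasIsotropicCommutant_iff_exists_mem_sphere, Set.mem_image,
    Prod.exists, Subtype.exists]
  constructor
  · rintro ⟨A, hA, h⟩
    exact ⟨A, hA, X, h, rfl⟩
  · rintro ⟨A, hA, _, h, rfl⟩
    exact ⟨A, hA, h⟩

lemma HasIsotropicCommutant.exists_isotropic_eigenvector {J X : Matrix n n ℂ}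
    (h : HasIsotropicCommutant J X) :
    ∃ (v : n → ℂ) (c : ℂ), v ≠ 0 ∧ X *ᵥ v = c • v ∧ star v ⬝ᵥ J *ᵥ v = 0 := by
  obtain ⟨A, hA, hX, hJ⟩ := h
  let R := LinearMap.range A.mulVecLin
  have hmaps : ∀ v ∈ R, X.mulVecLin v ∈ R := by
    rintro _ ⟨w, rfl⟩
    exact ⟨X *ᵥ w, by simp [hX]⟩
  have : Nontrivial R := by
    rw [Submodule.nontrivial_iff_ne_bot, Ne, LinearMap.range_eq_bot]
    intro h0
    refine hA (Matrix.toLin'.injective ?_)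
    rw [map_zero, ← h0]
    rfl
  obtain ⟨c, hc⟩ := Module.End.exists_eigenvalue (X.mulVecLin.restrict hmaps)
  obtain ⟨⟨v, w, hw⟩, hv⟩ := hc.exists_hasEigenvector
  refine ⟨v, c, fun h0 => hv.2 (Subtype.ext h0), congrArg Subtype.val hv.apply_eq_smul, ?_⟩
  rw [← hw, Matrix.mulVecLin_apply, star_mulVec, ← dotProduct_mulVec, mulVec_mulVec,
    mulVec_mulVec, hJ]
  simp

/-- An isotropic eigenvector with imaginary eigenvalue yields unipotent one-parameter
subgroups of the centralizer. -/
lemma one_add_smul_vecMulVec_mem_formCentralizer {J X : Matrix n n ℂ} (hJ : J * J = 1)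
    (hJh : Jᴴ = J) (hX : X * J + J * Xᴴ = 0) {v : n → ℂ} {c : ℂ} (hc : X *ᵥ v = c • v)
    (hre : c.re = 0) (hJv : star v ⬝ᵥ J *ᵥ v = 0) (t : ℝ) :
    1 + (t * Complex.I) • (vecMulVec v (star v) * J) ∈ formCentralizer J X := by
  have hcc : star c = -c := by
    apply Complex.ext <;> simp [hre]
  have hJX : J * X = -(Xᴴ * J) := by
    calc J * X = J * (X * J) * J := by simp only [mul_assoc, hJ, mul_one]
      _ = -(Xᴴ * J) := by
        rw [eq_neg_of_add_eq_zero_left hX, mul_neg, ← mul_assoc, hJ, one_mul, neg_mul]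
  have hsq : vecMulVec v (star v) * J * vecMulVec v (star v) = 0 := by
    rw [mul_assoc, mul_vecMulVec, vecMulVec_mul_vecMulVec, hJv]
    simp
  have hstar : (vecMulVec v (star v))ᴴ = vecMulVec v (star v) := by
    simp [conjTranspose_vecMulVec]
  refine ⟨?_, ?_⟩
  · have hJJ : vecMulVec v (star v) * J * J = vecMulVec v (star v) := by rw [mul_assoc, hJ, mul_one]
    simp [hstar, hJh, add_mul, mul_add, hJJ, ← mul_assoc, hJ, hsq]
  · have hleft : X * (vecMulVec v (star v) * J) = c • (vecMulVec v (star v) * J) := by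
      rw [← mul_assoc, mul_vecMulVec, hc, smul_vecMulVec, smul_mul_assoc]
    have hright : vecMulVec v (star v) * J * X = c • (vecMulVec v (star v) * J) := by
      rw [mul_assoc, hJX, mul_neg, ← mul_assoc, vecMulVec_mul, ← star_mulVec, hc, star_smul, hcc,
        neg_smul, vecMulVec_neg, vecMulVec_smul]
      simp
    simp [add_mul, mul_add, hleft, hright]

open scoped ComplexOrder in
lemma not_isCompact_formCentralizer {J X : Matrix n n ℂ} (hJ : J * J = 1) (hJh : Jᴴ = J)
    (hX : X * J + J * Xᴴ = 0) (h : HasIsotropicCommutant J X) :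
    ¬ IsCompact (formCentralizer J X) := by
  obtain ⟨v, c, hv, hc, hJv⟩ := h.exists_isotropic_eigenvector
  have hvv : 0 < ‖star v ⬝ᵥ v‖ := norm_pos_iff.mpr (dotProduct_star_self_eq_zero.not.mpr hv)
  intro hcomp
  have hbdd (w : n → ℂ) : ∃ C, ∀ g ∈ formCentralizer J X, ‖star v ⬝ᵥ g *ᵥ w‖ ≤ C := by
    obtain ⟨C, hC⟩ := hcomp.bddAbove_image (f := fun g => ‖star v ⬝ᵥ g *ᵥ w‖) (by fun_prop)
    exact ⟨C, fun g hg => hC ⟨g, hg, rfl⟩⟩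
  by_cases hre : c.re = 0
  · obtain ⟨C, hC⟩ := hbdd (J *ᵥ v)
    have hbound (t : ℝ) : |t| * (‖star v ⬝ᵥ v‖ * ‖star v ⬝ᵥ v‖) ≤ C := by
      have h := hC _ (one_add_smul_vecMulVec_mem_formCentralizer hJ hJh hX hc hre hJv t)
      have hval : star v ⬝ᵥ (1 + (t * Complex.I) • (vecMulVec v (star v) * J)) *ᵥ (J *ᵥ v)
          = t * Complex.I * ((star v ⬝ᵥ v) * (star v ⬝ᵥ v)) := by
        rw [add_mulVec, one_mulVec, dotProduct_add, hJv, zero_add, smul_mulVec, mulVec_mulVec,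
          mul_assoc, hJ, mul_one, vecMulVec_mulVec]
        simp
      rw [hval] at h
      simpa using h
    have hK := mul_pos hvv hvv
    have h := hbound ((|C| + 1) / (‖star v ⬝ᵥ v‖ * ‖star v ⬝ᵥ v‖))
    rw [abs_of_pos (by positivity), div_mul_cancel₀ _ hK.ne'] at h
    linarith [le_abs_self C]
  · obtain ⟨C, hC⟩ := hbdd v
    have hbound (t : ℝ) : Real.exp (t * c.re) * ‖star v ⬝ᵥ v‖ ≤ C := by
      have h := hC _ (exp_mem_formCentralizer hJ hX t)
      rw [exp_mulVec_of_mulVec_eq_smul (c := t * c) (by rw [smul_mulVec, hc, smul_smul]),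
        dotProduct_smul, smul_eq_mul, norm_mul, Complex.norm_exp] at h
      simpa using h
    have h := hbound (C / ‖star v ⬝ᵥ v‖ / c.re)
    rw [div_mul_cancel₀ _ hre, ← le_div_iff₀ hvv] at h
    linarith [Real.add_one_le_exp (C / ‖star v ⬝ᵥ v‖)]

open scoped ComplexOrder in
lemma not_hasIsotropicCommutant_I_smul {J : Matrix n n ℂ} (hJ : J * J = 1) :
    ¬ HasIsotropicCommutant J (Complex.I • J) := by
  rintro ⟨A, hA, hAX, hAJ⟩
  have hcomm : A * J = J * A := by simpa using hAX
  refine hA (conjTranspose_mul_self_eq_zero.mp ?_)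
  rw [mul_assoc, ← hcomm, ← mul_assoc] at hAJ
  calc Aᴴ * A = Aᴴ * A * J * J := by rw [mul_assoc _ J, hJ, mul_one]
    _ = 0 := by rw [hAJ, zero_mul]

end PseudoUnitary

theorem statement14 (p q : ℕ) (hq : 1 ≤ q) (hpq : q ≤ p) :
    {X | X ∈ upqLie p q ∧ IsCompact {g | g ∈ Upq p q ∧ g * X = X * g}}.Nonempty ∧
    IsOpen ((Subtype.val : upqLie p q → Matrix (Fin (p + q)) (Fin (p + q)) ℂ) ⁻¹'
      {X | IsCompact {g | g ∈ Upq p q ∧ g * X = X * g}}) := by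
  have hJ : Ipq p q * Ipq p q = 1 := by
    rw [Ipq, diagonal_mul_diagonal, ← diagonal_one]
    congr 1
    ext i
    split_ifs <;> simp
  have hJh : (Ipq p q)ᴴ = Ipq p q := by
    rw [Ipq, diagonal_conjTranspose]
    congr 1
    ext i
    simp only [Pi.star_apply]
    split_ifs <;> simp
  have hset (X : Matrix (Fin (p + q)) (Fin (p + q)) ℂ) :
      {g | g ∈ Upq p q ∧ g * X = X * g} = formCentralizer (Ipq p q) X := by
    ext g
    refine ⟨fun h => ⟨h.1.2, h.2⟩, fun h => ⟨⟨?_, h.1⟩, h.2⟩⟩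
    refine IsUnit.of_mul_eq_one (Ipq p q * gᴴ * Ipq p q) ?_
    rw [← mul_assoc, ← mul_assoc, h.1, hJ]
  simp only [hset]
  constructor
  · refine ⟨Complex.I • Ipq p q, ?_, isCompact_formCentralizer hJ ?_⟩
    · simp [upqLie, hJh, hJ]
    · exact not_hasIsotropicCommutant_I_smul hJ
  · convert (isClosed_setOf_hasIsotropicCommutant (Ipq p q)).isOpen_compl.preimage
      continuous_subtype_val using 1
    ext X
    exact ⟨fun h h' => not_isCompact_formCentralizer hJ hJh X.2 h' h,
      fun h => isCompact_formCentralizer hJ h⟩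
end
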